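/- Theorem A (matricial coefficient case): Let P ∈ M_k(ℂ⟨Z⟩) be a Q-stable atom. Then the dilated NGN quantities are uniformly bounded: there exists a finite constant C such that for every r ∈ [0,1), every n ≥ 1 and every X ∈ 𝔻_Q(n), the matrix P(rX) is invertible and both ‖P(rX)⁻¹ · P(X)‖ ≤ C and ‖P(X) · P(rX)⁻¹‖ ≤ C hold. -/

import Mathlib

open scoped Kronecker ENNReal

noncomputable section

/-- The operator norm of a square complex matrix acting on Euclidean (ℓ²) space. -/
def opNorm {m : Type*} [Fintype m] [DecidableEq m] (M : Matrix m m ℂ) : ℝ :=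
  ‖Matrix.toEuclideanCLM (𝕜 := ℂ) M‖

/-- Evaluation of a free polynomial in `ℂ⟨Z₁,…,Z_d⟩` at a `d`-tuple of `n×n`
complex matrices, i.e. the unital algebra homomorphism sending `Z_j` to `X_j`. -/
def ncEval {d n : ℕ} (X : Fin d → Matrix (Fin n) (Fin n) ℂ) :
    FreeAlgebra ℂ (Fin d) →ₐ[ℂ] Matrix (Fin n) (Fin n) ℂ :=
  FreeAlgebra.lift ℂ X

/-- Entrywise evaluation of a `k×k` matrix of free polynomials at a `d`-tuple of
`n×n` matrices, flattened to a `kn × kn` complex matrix. -/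
def ncEvalM {d k n : ℕ} (P : Matrix (Fin k) (Fin k) (FreeAlgebra ℂ (Fin d)))
    (X : Fin d → Matrix (Fin n) (Fin n) ℂ) :
    Matrix (Fin k × Fin n) (Fin k × Fin n) ℂ :=
  Matrix.of fun p q => ncEval X (P p.1 q.1) p.2 q.2

/-- Membership of `X` in the NC operator ball `𝔻_Q(n)`: `‖∑_j Q_j ⊗ X_j‖ < 1`. -/
def memBallQ {d l n : ℕ} (Q : Fin d → Matrix (Fin l) (Fin l) ℂ)
    (X : Fin d → Matrix (Fin n) (Fin n) ℂ) : Prop :=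
  opNorm (∑ j, Q j ⊗ₖ X j) < 1

/-- The supremum norm `‖G‖_Q ∈ [0,∞]` of a matrix free polynomial over `𝔻_Q`. -/
def normQ {d k l : ℕ} (Q : Fin d → Matrix (Fin l) (Fin l) ℂ)
    (G : Matrix (Fin k) (Fin k) (FreeAlgebra ℂ (Fin d))) : ℝ≥0∞ :=
  ⨆ (n : ℕ) (X : Fin d → Matrix (Fin (n + 1)) (Fin (n + 1)) ℂ) (_ : memBallQ Q X),
    ENNReal.ofReal (opNorm (ncEvalM G X))

/-- The supremum norm `‖p‖_Q ∈ [0,∞]` of a scalar free polynomial over `𝔻_Q`. -/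
def normQ1 {d l : ℕ} (Q : Fin d → Matrix (Fin l) (Fin l) ℂ)
    (p : FreeAlgebra ℂ (Fin d)) : ℝ≥0∞ :=
  ⨆ (n : ℕ) (X : Fin d → Matrix (Fin (n + 1)) (Fin (n + 1)) ℂ) (_ : memBallQ Q X),
    ENNReal.ofReal (opNorm (ncEval X p))

/-- `P ∈ M_k(ℂ⟨Z⟩)` is `Q`-stable if `P(X)` is invertible at every point of `𝔻_Q`. -/
def QStable {d k l : ℕ} (Q : Fin d → Matrix (Fin l) (Fin l) ℂ)
    (P : Matrix (Fin k) (Fin k) (FreeAlgebra ℂ (Fin d))) : Prop :=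
  ∀ (n : ℕ) (X : Fin d → Matrix (Fin (n + 1)) (Fin (n + 1)) ℂ),
    memBallQ Q X → IsUnit (ncEvalM P X)

/-- `P` is an atom of `M_k(ℂ⟨Z⟩)`: not invertible, and in any factorization
`P = F·G` one of the two factors is invertible. -/
def IsAtomPoly {d k : ℕ} (P : Matrix (Fin k) (Fin k) (FreeAlgebra ℂ (Fin d))) : Prop :=
  ¬ IsUnit P ∧ ∀ F G : Matrix (Fin k) (Fin k) (FreeAlgebra ℂ (Fin d)),
    P = F * G → IsUnit F ∨ IsUnit G

/-- A free polynomial is homogeneous of degree `j` if rescaling the generators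
by a scalar `t` rescales it by `t^j`. -/
def HomogeneousDeg {d : ℕ} (j : ℕ) (p : FreeAlgebra ℂ (Fin d)) : Prop :=
  ∀ t : ℂ, FreeAlgebra.lift ℂ (fun i => t • FreeAlgebra.ι ℂ i) p = t ^ j • p

end

noncomputable section

namespace NCAtom

open FreeAlgebra
open scoped Matrix

/-! ### Subspaces reached by a tuple of operators -/

section Preimage

variable {ι V V₂ : Type*} [AddCommGroup V] [Module ℂ V] [AddCommGroup V₂] [Module ℂ V₂]

/-- The subspace of vectors sent into `W` by every operator of the tuple `A`. -/
def pre (A : ι → Module.End ℂ V) (W : Submodule ℂ V) : Submodule ℂ V :=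
  ⨅ x, W.comap (A x)

lemma mem_pre {A : ι → Module.End ℂ V} {W : Submodule ℂ V} {v : V} :
    v ∈ pre A W ↔ ∀ x, A x v ∈ W := by
  simp [pre]

lemma pre_mono (A : ι → Module.End ℂ V) : Monotone (pre A) := fun _ _ h _ hv =>
  mem_pre.2 fun x => h (mem_pre.1 hv x)

lemma pre_iterate_monotone {A : ι → Module.End ℂ V} {W : Submodule ℂ V} (hW : W ≤ pre A W) :
    Monotone fun N => (pre A)^[N] W :=
  (pre_mono A).monotone_iterate_of_le_map hW

lemma bot_le_pre (A : ι → Module.End ℂ V) : ⊥ ≤ pre A ⊥ := bot_le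

lemma mem_pre_iterate_succ {A : ι → Module.End ℂ V} {W : Submodule ℂ V} {v : V} {N : ℕ} :
    v ∈ (pre A)^[N + 1] W ↔ ∀ x, A x v ∈ (pre A)^[N] W := by
  rw [Function.iterate_succ_apply', mem_pre]

/-- The subspace of vectors sent into `W` by all sufficiently long words in `A`. -/
def eventually (A : ι → Module.End ℂ V) (W : Submodule ℂ V) : Submodule ℂ V :=
  ⨆ N, (pre A)^[N] W

lemma mem_eventually {A : ι → Module.End ℂ V} {W : Submodule ℂ V} (hW : W ≤ pre A W)
    {v : V} :
    v ∈ eventually A W ↔ ∃ N, v ∈ (pre A)^[N] W :=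
  Submodule.mem_iSup_of_directed _ (pre_iterate_monotone hW).directed_le

lemma le_pre_iterate_of_fg {A : ι → Module.End ℂ V} {W U : Submodule ℂ V} (hW : W ≤ pre A W)
    (hU : U.FG) (h : U ≤ eventually A W) : ∃ N, U ≤ (pre A)^[N] W := by
  have hc : IsCompactElement U := (Submodule.fg_iff_compact U).1 hU
  obtain ⟨_, ⟨N, rfl⟩, hN⟩ := hc _ _ (Set.range_nonempty _)
    (directedOn_range.2 (pre_iterate_monotone hW).directed_le) isLUB_iSup h
  exact ⟨N, hN⟩

lemma comap_pre_iterate {A : ι → Module.End ℂ V} {B : ι → Module.End ℂ V₂} (f : V →ₗ[ℂ] V₂)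
    (hf : ∀ x v, f (A x v) = B x (f v)) (W : Submodule ℂ V₂) (N : ℕ) :
    ((pre B)^[N] W).comap f = (pre A)^[N] (W.comap f) := by
  induction N with
  | zero => rfl
  | succ N ih =>
    ext v
    rw [mem_pre_iterate_succ, Submodule.mem_comap, mem_pre_iterate_succ, ← ih]
    simp [hf]

end Preimage

/-! ### Left quotients in the free algebra -/

section Fox

variable {d k : ℕ}

/-- The representation `r ↦ !![ε r, ∂ₓ r; 0, r]` encoding the left quotient by a generator. -/
def foxHom (x : Fin d) :
    FreeAlgebra ℂ (Fin d) →ₐ[ℂ] Matrix (Fin 2) (Fin 2) (FreeAlgebra ℂ (Fin d)) :=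
  FreeAlgebra.lift ℂ fun y => !![0, if x = y then 1 else 0; 0, ι ℂ y]

lemma foxHom_one_zero (x : Fin d) (r : FreeAlgebra ℂ (Fin d)) : foxHom x r 1 0 = 0 := by
  induction r with
  | grade0 c => simp [Matrix.algebraMap_matrix_apply]
  | grade1 y => simp [foxHom]
  | mul a b ha hb => simp [Matrix.mul_apply, ha, hb]
  | add a b ha hb => simp [ha, hb]

lemma foxHom_one_one (x : Fin d) (r : FreeAlgebra ℂ (Fin d)) : foxHom x r 1 1 = r := by
  induction r with
  | grade0 c => simp [Matrix.algebraMap_matrix_apply]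
  | grade1 y => simp [foxHom]
  | mul a b ha hb => simp [Matrix.mul_apply, ha, hb, foxHom_one_zero]
  | add a b ha hb => simp [ha, hb]

/-- The left quotient by the generator `x`: the part of `r` beginning with `x`, with `x`
removed. -/
def fox (x : Fin d) : FreeAlgebra ℂ (Fin d) →ₗ[ℂ] FreeAlgebra ℂ (Fin d) where
  toFun r := foxHom x r 0 1
  map_add' a b := by simp
  map_smul' c a := by simp

lemma fox_ι_mul (x y : Fin d) (r : FreeAlgebra ℂ (Fin d)) :
    fox x (ι ℂ y * r) = if x = y then r else 0 := by
  change foxHom x (ι ℂ y * r) 0 1 = _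
  rw [map_mul, Matrix.mul_apply, Fin.sum_univ_two, foxHom_one_one]
  simp [foxHom]

lemma fox_algebraMap (x : Fin d) (c : ℂ) : fox x (algebraMap ℂ _ c) = 0 := by
  change foxHom x (algebraMap ℂ _ c) 0 1 = _
  simp [Matrix.algebraMap_matrix_apply]

lemma fox_one (x : Fin d) : fox x 1 = 0 := by
  simpa using fox_algebraMap x 1

lemma fox_ι (x y : Fin d) : fox x (ι ℂ y) = if x = y then 1 else 0 := by
  simpa using fox_ι_mul x y 1

lemma fox_mul (x : Fin d) (a b : FreeAlgebra ℂ (Fin d)) :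
    fox x (a * b) = algebraMapInv a • fox x b + fox x a * b := by
  have h0 : foxHom x a 0 0 = algebraMap ℂ _ (algebraMapInv a) := by
    induction a with
    | grade0 c => simp [Matrix.algebraMap_matrix_apply]
    | grade1 y => simp [foxHom, algebraMapInv]
    | mul a b ha hb => simp [Matrix.mul_apply, ha, hb, foxHom_one_zero]
    | add a b ha hb => simp [ha, hb]
  change foxHom x (a * b) 0 1 = _ • foxHom x b 0 1 + foxHom x a 0 1 * b
  rw [map_mul, Matrix.mul_apply, Fin.sum_univ_two, foxHom_one_one, h0, Algebra.smul_def]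

/-- Every element is its constant term plus the sum of its left quotients. -/
lemma eq_algebraMap_add_sum_fox (r : FreeAlgebra ℂ (Fin d)) :
    r = algebraMap ℂ _ (algebraMapInv r) + ∑ x, ι ℂ x * fox x r := by
  induction r with
  | grade0 c => simp [fox_algebraMap]
  | grade1 y => simp [fox_ι, algebraMapInv]
  | mul a b ha hb =>
    have : ∑ x, ι ℂ x * fox x (a * b)
        = algebraMapInv a • ∑ x, ι ℂ x * fox x b + (∑ x, ι ℂ x * fox x a) * b := by
      simp [fox_mul, mul_add, Finset.sum_add_distrib, Finset.smul_sum, Finset.sum_mul, mul_assoc]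
    rw [this, map_mul, map_mul, Algebra.smul_def]
    conv_lhs => rw [ha, add_mul]
    conv_lhs => enter [1]; rw [hb]
    rw [mul_add]
    abel
  | add a b ha hb =>
    conv_lhs => rw [ha, hb]
    simp only [map_add, mul_add, Finset.sum_add_distrib]
    abel

/-- The left quotient acting entrywise on row vectors. -/
def rowFox (k : ℕ) (x : Fin d) : Module.End ℂ (Fin k → FreeAlgebra ℂ (Fin d)) :=
  LinearMap.pi fun a => (fox x) ∘ₗ LinearMap.proj a

@[simp] lemma rowFox_apply (x : Fin d) (g : Fin k → FreeAlgebra ℂ (Fin d)) (a : Fin k) :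
    rowFox k x g a = fox x (g a) := rfl

/-- The vector of constant terms of a row of polynomials. -/
def rowConst (d k : ℕ) : (Fin k → FreeAlgebra ℂ (Fin d)) →ₗ[ℂ] (Fin k → ℂ) :=
  LinearMap.pi fun a => (algebraMapInv (R := ℂ) (X := Fin d)).toLinearMap ∘ₗ LinearMap.proj a

@[simp] lemma rowConst_apply (g : Fin k → FreeAlgebra ℂ (Fin d)) (a : Fin k) :
    rowConst d k g a = algebraMapInv (g a) := rfl

/-- Constant rows of polynomials. -/
def constRow (d k : ℕ) : (Fin k → ℂ) →ₗ[ℂ] (Fin k → FreeAlgebra ℂ (Fin d)) :=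
  LinearMap.pi fun a => (Algebra.linearMap ℂ (FreeAlgebra ℂ (Fin d))) ∘ₗ LinearMap.proj a

@[simp] lemma constRow_apply (c : Fin k → ℂ) (a : Fin k) :
    constRow d k c a = algebraMap ℂ _ (c a) := rfl

lemma row_eq (g : Fin k → FreeAlgebra ℂ (Fin d)) :
    g = constRow d k (rowConst d k g) + ∑ x, ι ℂ x • rowFox k x g := by
  funext a
  simpa using eq_algebraMap_add_sum_fox (g a)

lemma rowFox_ι_smul (x y : Fin d) (g : Fin k → FreeAlgebra ℂ (Fin d)) :
    rowFox k x (ι ℂ y • g) = if x = y then g else 0 := by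
  funext a
  rw [rowFox_apply, Pi.smul_apply, smul_eq_mul, fox_ι_mul]
  split_ifs <;> rfl

/-- A subspace of vectors eventually absorbed by `W` is a left submodule as soon as the operators
undo multiplication by the generators. -/
lemma smul_mem_eventually {B : Fin d → Module.End ℂ (Fin k → FreeAlgebra ℂ (Fin d))}
    (hB : ∀ x y m, B x (ι ℂ y • m) = if x = y then m else 0)
    {W : Submodule ℂ (Fin k → FreeAlgebra ℂ (Fin d))} (hW : W ≤ pre B W)
    (r : FreeAlgebra ℂ (Fin d)) :
    ∀ m ∈ eventually B W, r • m ∈ eventually B W := by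
  induction r with
  | grade0 c =>
    intro m hm
    rw [algebraMap_smul]
    exact Submodule.smul_mem _ _ hm
  | grade1 y =>
    intro m hm
    obtain ⟨N, hN⟩ := (mem_eventually hW).1 hm
    refine (mem_eventually hW).2 ⟨N + 1, mem_pre_iterate_succ.2 fun x => ?_⟩
    rw [hB]
    split_ifs
    exacts [hN, Submodule.zero_mem _]
  | mul a b ha hb =>
    intro m hm
    rw [mul_smul]
    exact ha _ (hb _ hm)
  | add a b ha hb =>
    intro m hm
    rw [add_smul]
    exact Submodule.add_mem _ (ha _ hm) (hb _ hm)

lemma span_le_eventually {B : Fin d → Module.End ℂ (Fin k → FreeAlgebra ℂ (Fin d))}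
    (hB : ∀ x y m, B x (ι ℂ y • m) = if x = y then m else 0)
    {W : Submodule ℂ (Fin k → FreeAlgebra ℂ (Fin d))} (hW : W ≤ pre B W)
    {s : Set (Fin k → FreeAlgebra ℂ (Fin d))} (hs : ∀ m ∈ s, m ∈ eventually B W)
    {m : Fin k → FreeAlgebra ℂ (Fin d)} (hm : m ∈ Submodule.span (FreeAlgebra ℂ (Fin d)) s) :
    m ∈ eventually B W := by
  induction hm using Submodule.span_induction with
  | mem m hm => exact hs m hm
  | zero => exact Submodule.zero_mem _
  | add a b _ _ ha hb => exact Submodule.add_mem _ ha hb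
  | smul r m _ hm => exact smul_mem_eventually hB hW r m hm

lemma mem_span_rows_one (g : Fin k → FreeAlgebra ℂ (Fin d)) :
    g ∈ Submodule.span (FreeAlgebra ℂ (Fin d))
      (Set.range (1 : Matrix (Fin k) (Fin k) (FreeAlgebra ℂ (Fin d)))) := by
  refine (Submodule.mem_span_range_iff_exists_fun _).2 ⟨g, ?_⟩
  funext b
  simp [Matrix.one_apply]

/-- Every row of polynomials is killed by all long words in the left quotients. -/
lemma mem_eventually_rowFox (g : Fin k → FreeAlgebra ℂ (Fin d)) :
    g ∈ eventually (rowFox (d := d) k) ⊥ := by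
  refine span_le_eventually rowFox_ι_smul (bot_le_pre _) ?_ (mem_span_rows_one g)
  rintro _ ⟨a, rfl⟩
  refine (mem_eventually (bot_le_pre _)).2 ⟨1, mem_pre_iterate_succ.2 fun x => ?_⟩
  rw [Function.iterate_zero, id_eq, Submodule.mem_bot]
  funext b
  rw [rowFox_apply, Matrix.one_apply]
  split_ifs
  exacts [fox_one x, map_zero _]

/-- Rows of polynomials of degree less than `n`. -/
def degLT (d k n : ℕ) : Submodule ℂ (Fin k → FreeAlgebra ℂ (Fin d)) :=
  (pre (rowFox k))^[n] ⊥

lemma degLT_mono : Monotone (degLT d k) := pre_iterate_monotone (bot_le_pre _)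

lemma exists_mem_degLT (g : Fin k → FreeAlgebra ℂ (Fin d)) : ∃ n, g ∈ degLT d k n :=
  (mem_eventually (bot_le_pre _)).1 (mem_eventually_rowFox g)

lemma mem_degLT_zero {g : Fin k → FreeAlgebra ℂ (Fin d)} : g ∈ degLT d k 0 ↔ g = 0 := Iff.rfl

lemma mem_degLT_succ {g : Fin k → FreeAlgebra ℂ (Fin d)} {n : ℕ} :
    g ∈ degLT d k (n + 1) ↔ ∀ x, rowFox k x g ∈ degLT d k n := mem_pre_iterate_succ

lemma rowFox_constRow (x : Fin d) (c : Fin k → ℂ) : rowFox k x (constRow d k c) = 0 := by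
  funext a
  simp [fox_algebraMap]

lemma constRow_mem_degLT (c : Fin k → ℂ) : constRow d k c ∈ degLT d k 1 :=
  mem_degLT_succ.2 fun x => by
    rw [rowFox_constRow]
    exact Submodule.zero_mem _

lemma degLT_fg (n : ℕ) : (degLT d k n).FG := by
  induction n with
  | zero => exact Submodule.fg_bot
  | succ n ih =>
    let mulι : Fin d → Module.End ℂ (Fin k → FreeAlgebra ℂ (Fin d)) := fun x =>
      LinearMap.pi fun a => LinearMap.mulLeft ℂ (ι ℂ x) ∘ₗ LinearMap.proj a
    have hfg : (LinearMap.range (constRow d k) ⊔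
        ⨆ x, (degLT d k n).map (mulι x)).FG := by
      refine Submodule.FG.sup ?_ (Submodule.fg_iSup _ fun x => ih.map _)
      rw [LinearMap.range_eq_map]
      exact Module.Finite.fg_top.map _
    have : FiniteDimensional ℂ ↥(LinearMap.range (constRow d k) ⊔
        ⨆ x, (degLT d k n).map (mulι x)) := Module.Finite.iff_fg.2 hfg
    have hle : degLT d k (n + 1) ≤ LinearMap.range (constRow d k) ⊔
        ⨆ x, (degLT d k n).map (mulι x) := by
      intro g hg
      rw [row_eq g]
      refine Submodule.add_mem_sup ⟨_, rfl⟩ (Submodule.sum_mem _ fun x _ => ?_)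
      exact Submodule.mem_iSup_of_mem x ⟨_, mem_degLT_succ.1 hg x, rfl⟩
    exact Module.Finite.iff_fg.1 (Submodule.finiteDimensional_of_le hle)

end Fox

/-! ### The companion operators of a matrix polynomial and factorizations -/

section Companion

variable {d k : ℕ}

/-- The matrix of constant terms. -/
def constMat (P : Matrix (Fin k) (Fin k) (FreeAlgebra ℂ (Fin d))) : Matrix (Fin k) (Fin k) ℂ :=
  P.map algebraMapInv

/-- Coordinates, in the rows of `P`, of the combination of rows sharing the constant term of a
given row. -/
def lead (P : Matrix (Fin k) (Fin k) (FreeAlgebra ℂ (Fin d))) :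
    (Fin k → FreeAlgebra ℂ (Fin d)) →ₗ[ℂ] (Fin k → ℂ) :=
  Matrix.vecMulLinear (constMat P)⁻¹ ∘ₗ rowConst d k

/-- The companion operators of `P`: remove the constant term by subtracting a combination of rows
of `P`, then take the left quotient. -/
def companion (P : Matrix (Fin k) (Fin k) (FreeAlgebra ℂ (Fin d))) (x : Fin d) :
    Module.End ℂ (Fin k → FreeAlgebra ℂ (Fin d)) :=
  rowFox k x ∘ₗ (LinearMap.id - Fintype.linearCombination ℂ P ∘ₗ lead P)

variable {P : Matrix (Fin k) (Fin k) (FreeAlgebra ℂ (Fin d))}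

lemma companion_apply (x : Fin d) (g : Fin k → FreeAlgebra ℂ (Fin d)) :
    companion P x g = rowFox k x (g - ∑ b, lead P g b • P b) := by
  simp only [companion, LinearMap.comp_apply, LinearMap.sub_apply, LinearMap.id_apply]
  rfl

lemma rowConst_ι_smul (y : Fin d) (m : Fin k → FreeAlgebra ℂ (Fin d)) :
    rowConst d k (ι ℂ y • m) = 0 := by
  funext a
  simp [algebraMapInv]

lemma companion_ι_smul (x y : Fin d) (m : Fin k → FreeAlgebra ℂ (Fin d)) :
    companion P x (ι ℂ y • m) = if x = y then m else 0 := by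
  have : lead P (ι ℂ y • m) = 0 := by
    rw [lead, LinearMap.comp_apply, rowConst_ι_smul, map_zero]
  simp only [companion_apply, this, Pi.zero_apply, zero_smul, Finset.sum_const_zero, sub_zero,
    rowFox_ι_smul]

lemma rowConst_sub_lead (hP : IsUnit (constMat P)) (g : Fin k → FreeAlgebra ℂ (Fin d)) :
    rowConst d k (g - ∑ b, lead P g b • P b) = 0 := by
  have h1 : rowConst d k (∑ b, lead P g b • P b) = Matrix.vecMul (lead P g) (constMat P) := by
    funext a
    simp [Matrix.vecMul, dotProduct, constMat]
  have h2 : Matrix.vecMul (lead P g) (constMat P) = rowConst d k g := by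
    rw [lead, LinearMap.comp_apply, Matrix.vecMulLinear_apply, Matrix.vecMul_vecMul,
      Matrix.nonsing_inv_mul _ ((Matrix.isUnit_iff_isUnit_det _).1 hP), Matrix.vecMul_one]
  rw [map_sub, h1, h2, sub_self]

lemma companion_eq (hP : IsUnit (constMat P)) (g : Fin k → FreeAlgebra ℂ (Fin d)) :
    g = ∑ b, lead P g b • P b + ∑ x, ι ℂ x • companion P x g := by
  have := row_eq (g - ∑ b, lead P g b • P b)
  rw [rowConst_sub_lead hP, map_zero, zero_add] at this
  simp only [companion_apply]
  rw [← this]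
  abel

lemma rowConst_row (a : Fin k) : rowConst d k (P a) =
    Matrix.vecMul (Pi.single a 1) (constMat P) := by
  funext b
  simp [constMat]

lemma lead_row (hP : IsUnit (constMat P)) (a : Fin k) : lead P (P a) = Pi.single a 1 := by
  rw [lead, LinearMap.comp_apply, rowConst_row, Matrix.vecMulLinear_apply, Matrix.vecMul_vecMul,
    Matrix.mul_nonsing_inv _ ((Matrix.isUnit_iff_isUnit_det _).1 hP), Matrix.vecMul_one]

lemma companion_row (hP : IsUnit (constMat P)) (x : Fin d) (a : Fin k) :
    companion P x (P a) = 0 := by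
  have : ∑ b, (Pi.single a (1 : ℂ) : Fin k → ℂ) b • P b = P a := by
    rw [Finset.sum_eq_single a (fun b _ hb => by simp [hb]) (by simp)]
    simp
  rw [companion_apply, lead_row hP, this, sub_self, map_zero]

/-- The `ℂ`-subspace `∑ₓ x M`. -/
def augMul (M : Submodule ℂ (Fin k → FreeAlgebra ℂ (Fin d))) :
    Submodule ℂ (Fin k → FreeAlgebra ℂ (Fin d)) :=
  ⨆ x, M.map (LinearMap.pi fun a => LinearMap.mulLeft ℂ (ι ℂ x) ∘ₗ LinearMap.proj a :
    Module.End ℂ (Fin k → FreeAlgebra ℂ (Fin d)))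

lemma ι_smul_mem_augMul {M : Submodule ℂ (Fin k → FreeAlgebra ℂ (Fin d))}
    {m : Fin k → FreeAlgebra ℂ (Fin d)} (hm : m ∈ M) (x : Fin d) : ι ℂ x • m ∈ augMul M :=
  Submodule.mem_iSup_of_mem x ⟨m, hm, rfl⟩

lemma rowFox_mem_of_mem_augMul {M : Submodule ℂ (Fin k → FreeAlgebra ℂ (Fin d))}
    {m : Fin k → FreeAlgebra ℂ (Fin d)} (hm : m ∈ augMul M) (x : Fin d) : rowFox k x m ∈ M := by
  suffices augMul M ≤ M.comap (rowFox k x) from this hm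
  refine iSup_le fun y => ?_
  rintro _ ⟨m, hm, rfl⟩
  change rowFox k x (ι ℂ y • m) ∈ M
  rw [rowFox_ι_smul]
  split_ifs
  exacts [hm, Submodule.zero_mem _]

lemma rowConst_of_mem_augMul {M : Submodule ℂ (Fin k → FreeAlgebra ℂ (Fin d))}
    {m : Fin k → FreeAlgebra ℂ (Fin d)} (hm : m ∈ augMul M) : rowConst d k m = 0 := by
  suffices augMul M ≤ LinearMap.ker (rowConst d k) from this hm
  refine iSup_le fun y => ?_
  rintro _ ⟨m, hm, rfl⟩
  exact rowConst_ι_smul y m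

open Classical in
/-- The degree (plus one) of a row of polynomials. -/
def rowDeg (g : Fin k → FreeAlgebra ℂ (Fin d)) : ℕ := Nat.find (exists_mem_degLT g)

open Classical in
lemma rowDeg_le_iff {g : Fin k → FreeAlgebra ℂ (Fin d)} {n : ℕ} :
    rowDeg g ≤ n ↔ g ∈ degLT d k n :=
  ⟨fun h => degLT_mono h (Nat.find_spec (exists_mem_degLT g)), fun h => Nat.find_min' _ h⟩

/-- A left submodule of the free module of rows which is spanned modulo `∑ₓ x M` by `k` vectors
is generated by `k` vectors. -/
lemma exists_generators (M : Submodule (FreeAlgebra ℂ (Fin d)) (Fin k → FreeAlgebra ℂ (Fin d)))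
    (s₀ : Fin k → Fin k → FreeAlgebra ℂ (Fin d)) (hs₀ : ∀ i, s₀ i ∈ M)
    (hspan : M.restrictScalars ℂ ≤
      Submodule.span ℂ (Set.range s₀) ⊔ augMul (M.restrictScalars ℂ)) :
    ∃ s : Fin k → Fin k → FreeAlgebra ℂ (Fin d),
      M = Submodule.span (FreeAlgebra ℂ (Fin d)) (Set.range s) := by
  let adm : Set (Fin k → Fin k → FreeAlgebra ℂ (Fin d)) := {s | (∀ i, s i ∈ M) ∧
    M.restrictScalars ℂ ≤ Submodule.span ℂ (Set.range s) ⊔ augMul (M.restrictScalars ℂ)}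
  obtain ⟨s, ⟨hsM, hs⟩, hmin⟩ : ∃ s ∈ adm, ∀ t ∈ adm, ∑ i, rowDeg (s i) ≤ ∑ i, rowDeg (t i) := by
    have hne : (Set.image (fun s => ∑ i, rowDeg (s i)) adm).Nonempty := ⟨_, s₀, ⟨hs₀, hspan⟩, rfl⟩
    obtain ⟨s, hs, hsn⟩ := Nat.sInf_mem hne
    exact ⟨s, hs, fun t ht => hsn.trans_le (Nat.sInf_le ⟨t, ht, rfl⟩)⟩
  refine ⟨s, le_antisymm ?_ (Submodule.span_le.2 (by rintro _ ⟨i, rfl⟩; exact hsM i))⟩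
  suffices ∀ n, ∀ m ∈ M, m ∈ degLT d k n →
      m ∈ Submodule.span (FreeAlgebra ℂ (Fin d)) (Set.range s) from
    fun m hm => this _ m hm (exists_mem_degLT m).choose_spec
  intro n
  induction n with
  | zero =>
    intro m _ h0
    rw [mem_degLT_zero.1 h0]
    exact Submodule.zero_mem _
  | succ n ih =>
    intro m hm hmn
    obtain ⟨y, hy, z, hz, hyz⟩ := Submodule.mem_sup.1 (hs hm)
    obtain ⟨c, rfl⟩ := (Submodule.mem_span_range_iff_exists_fun ℂ).1 hy
    have hdeg : ∀ i, c i ≠ 0 → s i ∈ degLT d k (n + 1) := by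
      intro i hi
      by_contra hcon
      have hlt : rowDeg m < rowDeg (s i) :=
        (rowDeg_le_iff.2 hmn).trans_lt (not_le.1 fun h => hcon (rowDeg_le_iff.1 h))
      have ht : Function.update s i m ∈ adm := by
        refine ⟨fun j => ?_, ?_⟩
        · by_cases h : j = i
          · subst h; simpa using hm
          · simpa [h] using hsM j
        · refine hs.trans (sup_le (Submodule.span_le.2 ?_) le_sup_right)
          have hmem : ∀ j, j ≠ i → s j ∈ Submodule.span ℂ (Set.range (Function.update s i m)) ⊔
              augMul (M.restrictScalars ℂ) := fun j hj =>
            Submodule.mem_sup_left (Submodule.subset_span ⟨j, by simp [hj]⟩)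
          rintro _ ⟨j, rfl⟩
          by_cases hj : j = i
          · subst hj
            have : s j = (c j)⁻¹ • (m - ∑ b ∈ Finset.univ.erase j, c b • s b - z) := by
              rw [← hyz, ← Finset.add_sum_erase _ _ (Finset.mem_univ j)]
              rw [eq_inv_smul_iff₀ hi]
              abel
            rw [SetLike.mem_coe, this]
            refine Submodule.smul_mem _ _ (Submodule.sub_mem _ (Submodule.sub_mem _ ?_ ?_) ?_)
            · exact Submodule.mem_sup_left (Submodule.subset_span ⟨j, by simp⟩)
            · exact Submodule.sum_mem _ fun b hb =>
                Submodule.smul_mem _ _ (hmem b (Finset.ne_of_mem_erase hb))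
            · exact Submodule.mem_sup_right hz
          · exact hmem j hj
      refine absurd (hmin _ ht) (not_le.2 (Finset.sum_lt_sum (fun j _ => ?_)
        ⟨i, Finset.mem_univ i, by simpa using hlt⟩))
      by_cases h : j = i
      · subst h; simpa using hlt.le
      · simp [h]
    have hzn : z ∈ degLT d k (n + 1) := by
      rw [← add_sub_cancel_left (∑ i, c i • s i) z, hyz]
      refine Submodule.sub_mem _ hmn (Submodule.sum_mem _ fun i _ => ?_)
      by_cases h : c i = 0
      · rw [h, zero_smul]; exact Submodule.zero_mem _
      · exact Submodule.smul_mem _ _ (hdeg i h)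
    have hzs : z ∈ Submodule.span (FreeAlgebra ℂ (Fin d)) (Set.range s) := by
      rw [row_eq z, rowConst_of_mem_augMul hz, map_zero, zero_add]
      exact Submodule.sum_mem _ fun x _ => Submodule.smul_mem _ _
        (ih _ (rowFox_mem_of_mem_augMul hz x) (mem_degLT_succ.1 hzn x))
    rw [← hyz]
    refine Submodule.add_mem _ (Submodule.sum_mem _ fun i _ => ?_) hzs
    rw [← algebraMap_smul (FreeAlgebra ℂ (Fin d)) (c i) (s i)]
    exact Submodule.smul_mem _ _ (Submodule.subset_span ⟨i, rfl⟩)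

lemma range_subset_span_of_eq_mul {F G H : Matrix (Fin k) (Fin k) (FreeAlgebra ℂ (Fin d))}
    (h : H = F * G) (a : Fin k) :
    H a ∈ Submodule.span (FreeAlgebra ℂ (Fin d)) (Set.range G) := by
  refine (Submodule.mem_span_range_iff_exists_fun _).2 ⟨F a, ?_⟩
  funext b
  simp [h, Matrix.mul_apply]

/-- For an atom, the companion operators are eventually zero on any invariant subspace, or
on the corresponding quotient. -/
theorem isAtomPoly_dichotomy (hatom : IsAtomPoly P) (hP : IsUnit (constMat P))
    {W : Submodule ℂ (Fin k → FreeAlgebra ℂ (Fin d))} (hW : W ≤ pre (companion P) W) :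
    W ≤ eventually (companion P) ⊥ ∨ ⊤ ≤ eventually (companion P) W := by
  let M : Submodule (FreeAlgebra ℂ (Fin d)) (Fin k → FreeAlgebra ℂ (Fin d)) :=
    Submodule.span _ ((W : Set _) ∪ Set.range P)
  have hWM : ∀ g ∈ W, g ∈ M := fun g hg => Submodule.subset_span (Or.inl hg)
  have hPM : ∀ a, P a ∈ M := fun a => Submodule.subset_span (Or.inr ⟨a, rfl⟩)
  have hspan : M.restrictScalars ℂ ≤
      Submodule.span ℂ (Set.range P) ⊔ augMul (M.restrictScalars ℂ) := by
    intro m hm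
    rw [companion_eq hP m]
    refine Submodule.add_mem_sup (Submodule.sum_mem _ fun b _ =>
      Submodule.smul_mem _ _ (Submodule.subset_span ⟨b, rfl⟩)) (Submodule.sum_mem _ fun x _ =>
      ι_smul_mem_augMul (?_ : companion P x m ∈ M) x)
    have hm' : m ∈ M := hm
    suffices ∀ r : FreeAlgebra ℂ (Fin d), ∀ m ∈ M, companion P x m ∈ M →
        companion P x (r • m) ∈ M by
      clear hm
      induction hm' using Submodule.span_induction with
      | mem g hg =>
        rcases hg with hg | ⟨a, rfl⟩
        · exact hWM _ (mem_pre.1 (hW hg) x)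
        · rw [companion_row hP]; exact Submodule.zero_mem _
      | zero => rw [map_zero]; exact Submodule.zero_mem _
      | add a b _ _ ha hb => rw [map_add]; exact Submodule.add_mem _ ha hb
      | smul r m hm h => exact this r m hm h
    intro r m hm h
    have hr : r • m = algebraMapInv r • m + ∑ y, ι ℂ y • (fox y r • m) := by
      conv_lhs => rw [eq_algebraMap_add_sum_fox r, add_smul, algebraMap_smul, Finset.sum_smul]
      simp_rw [mul_smul]
    rw [hr, map_add, map_smul, map_sum]
    refine Submodule.add_mem _ ?_ (Submodule.sum_mem _ fun y _ => ?_)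
    · rw [← algebraMap_smul (FreeAlgebra ℂ (Fin d)) (algebraMapInv r)]
      exact Submodule.smul_mem _ _ h
    · rw [companion_ι_smul]
      split_ifs
      exacts [Submodule.smul_mem _ _ hm, Submodule.zero_mem _]
  obtain ⟨G, hG⟩ := exists_generators M P hPM hspan
  have hF : ∀ a, ∃ c : Fin k → FreeAlgebra ℂ (Fin d), ∑ i, c i • G i = P a := fun a =>
    (Submodule.mem_span_range_iff_exists_fun _).1 (hG ▸ hPM a)
  choose F hF using hF
  have hPFG : P = Matrix.of F * Matrix.of G := by
    ext a b
    rw [← hF a]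
    simp [Matrix.mul_apply]
  rcases hatom.2 _ _ hPFG with hu | hu
  · left
    obtain ⟨u, hu⟩ := hu
    have hGP : Matrix.of G = (↑u⁻¹ : Matrix _ _ _) * P := by
      rw [hPFG, ← hu, Units.inv_mul_cancel_left]
    intro g hg
    have hgM : g ∈ Submodule.span (FreeAlgebra ℂ (Fin d)) (Set.range P) := by
      refine Submodule.span_le.2 ?_ (hG ▸ hWM g hg)
      rintro _ ⟨a, rfl⟩
      exact range_subset_span_of_eq_mul hGP a
    refine span_le_eventually companion_ι_smul (bot_le_pre _) ?_ hgM
    rintro _ ⟨a, rfl⟩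
    refine (mem_eventually (bot_le_pre _)).2 ⟨1, mem_pre_iterate_succ.2 fun x => ?_⟩
    rw [companion_row hP]
    exact Submodule.zero_mem _
  · right
    obtain ⟨u, hu⟩ := hu
    have h1G : (1 : Matrix (Fin k) (Fin k) (FreeAlgebra ℂ (Fin d))) =
        (↑u⁻¹ : Matrix _ _ _) * Matrix.of G := by
      rw [← hu, Units.inv_mul]
    intro g _
    have hgM : g ∈ M := by
      have h1M : ∀ a, (1 : Matrix (Fin k) (Fin k) (FreeAlgebra ℂ (Fin d))) a ∈ M := fun a =>
        hG ▸ range_subset_span_of_eq_mul h1G a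
      refine Submodule.span_le.2 ?_ (mem_span_rows_one g)
      rintro _ ⟨a, rfl⟩
      exact h1M a
    refine span_le_eventually companion_ι_smul hW ?_ hgM
    rintro _ (hg | ⟨a, rfl⟩)
    · exact (mem_eventually hW).2 ⟨0, hg⟩
    · refine (mem_eventually hW).2 ⟨1, mem_pre_iterate_succ.2 fun x => ?_⟩
      rw [companion_row hP]
      exact Submodule.zero_mem _

end Companion

/-! ### The action of matrix tuples on tuples of vectors -/

section Ampl

variable {d n : ℕ} {V V₂ : Type*} [AddCommGroup V] [Module ℂ V] [AddCommGroup V₂] [Module ℂ V₂]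

/-- The operator `∑ₓ Aₓ ⊗ Xₓ` acting on tuples of vectors. -/
def ampl (A : Fin d → Module.End ℂ V) (X : Fin d → Matrix (Fin n) (Fin n) ℂ) :
    Module.End ℂ (Fin n → V) :=
  LinearMap.pi fun i => ∑ x, ∑ j, X x j i • (A x ∘ₗ LinearMap.proj j)

lemma ampl_apply (A : Fin d → Module.End ℂ V) (X : Fin d → Matrix (Fin n) (Fin n) ℂ)
    (ξ : Fin n → V) (i : Fin n) : ampl A X ξ i = ∑ x, ∑ j, X x j i • A x (ξ j) := by
  simp [ampl]

lemma ampl_smul (A : Fin d → Module.End ℂ V) (X : Fin d → Matrix (Fin n) (Fin n) ℂ) (c : ℂ) :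
    ampl A (fun x => c • X x) = c • ampl A X := by
  refine LinearMap.ext fun ξ => funext fun i => ?_
  simp [ampl_apply, Finset.smul_sum, mul_smul]

lemma ampl_map {A : Fin d → Module.End ℂ V} {B : Fin d → Module.End ℂ V₂} (f : V →ₗ[ℂ] V₂)
    (hf : ∀ x v, f (A x v) = B x (f v)) (X : Fin d → Matrix (Fin n) (Fin n) ℂ) (ξ : Fin n → V) :
    (fun i => f (ampl A X ξ i)) = ampl B X fun i => f (ξ i) := by
  funext i
  simp [ampl_apply, hf]

/-- The tuple `A` has no eigenvalue one along the operator ball of `Q`. -/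
def Stable {l : ℕ} (Q : Fin d → Matrix (Fin l) (Fin l) ℂ) (A : Fin d → Module.End ℂ V) : Prop :=
  ∀ (n : ℕ) (X : Fin d → Matrix (Fin n) (Fin n) ℂ), memBallQ Q X →
    ∀ ξ : Fin n → V, ampl A X ξ = ξ → ξ = 0

lemma Stable.of_injective {l : ℕ} {Q : Fin d → Matrix (Fin l) (Fin l) ℂ}
    {A : Fin d → Module.End ℂ V} {B : Fin d → Module.End ℂ V₂} (hB : Stable Q B)
    (f : V →ₗ[ℂ] V₂) (hf : ∀ x v, f (A x v) = B x (f v)) (hinj : Function.Injective f) :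
    Stable Q A := by
  intro n X hX ξ hξ
  have := hB n X hX (fun i => f (ξ i)) (by rw [← ampl_map f hf, hξ])
  funext i
  exact hinj (by simpa using congrFun this i)

lemma ampl_mem {A : Fin d → Module.End ℂ V} {W W' : Submodule ℂ V} (h : W ≤ pre A W')
    (X : Fin d → Matrix (Fin n) (Fin n) ℂ) {ξ : Fin n → V} (hξ : ∀ i, ξ i ∈ W) (i : Fin n) :
    ampl A X ξ i ∈ W' := by
  rw [ampl_apply]
  exact Submodule.sum_mem _ fun x _ => Submodule.sum_mem _ fun j _ =>
    Submodule.smul_mem _ _ (mem_pre.1 (h (hξ j)) x)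

lemma ampl_iterate_mem {A : Fin d → Module.End ℂ V} {W : Submodule ℂ V} {N : ℕ}
    (X : Fin d → Matrix (Fin n) (Fin n) ℂ) {ξ : Fin n → V} (hξ : ∀ i, ξ i ∈ (pre A)^[N] W)
    (i : Fin n) : (ampl A X ^ N) ξ i ∈ W := by
  induction N generalizing ξ with
  | zero => exact hξ i
  | succ N ih =>
    rw [pow_succ]
    refine ih fun j => ?_
    exact ampl_mem (W := (pre A)^[N + 1] W)
      (by rw [Function.iterate_succ_apply']) X hξ j

end Ampl

/-! ### Evaluation of the companion operators -/

section Eval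

variable {d k n : ℕ}

/-- Evaluation of a tuple of rows of polynomials. -/
def evalTuple (k : ℕ) (X : Fin d → Matrix (Fin n) (Fin n) ℂ) :
    (Fin n → Fin k → FreeAlgebra ℂ (Fin d)) →ₗ[ℂ] (Fin k × Fin n → ℂ) where
  toFun ξ p := ∑ j, ncEval X (ξ j p.1) j p.2
  map_add' ξ η := by
    funext p
    simp [Finset.sum_add_distrib]
  map_smul' c ξ := by
    funext p
    simp [Finset.mul_sum]

lemma evalTuple_apply (X : Fin d → Matrix (Fin n) (Fin n) ℂ)
    (ξ : Fin n → Fin k → FreeAlgebra ℂ (Fin d)) (p : Fin k × Fin n) :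
    evalTuple k X ξ p = ∑ j, ncEval X (ξ j p.1) j p.2 := rfl

lemma evalTuple_constRow (X : Fin d → Matrix (Fin n) (Fin n) ℂ) (b : Fin n → Fin k → ℂ) :
    evalTuple k X (fun i => constRow d k (b i)) = fun p => b p.2 p.1 := by
  funext p
  rw [evalTuple_apply]
  simp [Matrix.algebraMap_matrix_apply]

variable {P : Matrix (Fin k) (Fin k) (FreeAlgebra ℂ (Fin d))}

lemma evalTuple_eq (hP : IsUnit (constMat P)) (X : Fin d → Matrix (Fin n) (Fin n) ℂ)
    (ξ : Fin n → Fin k → FreeAlgebra ℂ (Fin d)) :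
    evalTuple k X ξ = Matrix.vecMul (fun p => lead P (ξ p.2) p.1) (ncEvalM P X) +
      evalTuple k X (ampl (companion P) X ξ) := by
  funext p
  have h : ∀ j, ncEval X (ξ j p.1) j p.2 = ∑ b, lead P (ξ j) b * ncEval X (P b p.1) j p.2 +
      ∑ x, ∑ i, X x j i * ncEval X (companion P x (ξ j) p.1) i p.2 := by
    intro j
    conv_lhs => rw [companion_eq hP (ξ j)]
    simp [Matrix.sum_apply, Matrix.add_apply, Matrix.mul_apply, ncEval]
  rw [Pi.add_apply, evalTuple_apply, evalTuple_apply]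
  simp_rw [h]
  rw [Finset.sum_add_distrib]
  congr 1
  · simp only [Matrix.vecMul, dotProduct, Fintype.sum_prod_type, ncEvalM, Matrix.of_apply]
    exact Finset.sum_comm
  · simp only [ampl_apply, Finset.sum_apply, Pi.smul_apply, map_sum, map_smul, Matrix.sum_apply,
      Matrix.smul_apply, smul_eq_mul]
    rw [Finset.sum_comm]
    conv_rhs => rw [Finset.sum_comm]
    exact Finset.sum_congr rfl fun x _ => Finset.sum_comm

lemma vecMul_lead (hP : IsUnit (constMat P)) (X : Fin d → Matrix (Fin n) (Fin n) ℂ)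
    {ξ : Fin n → Fin k → FreeAlgebra ℂ (Fin d)} {b : Fin n → Fin k → ℂ}
    (h : ξ - ampl (companion P) X ξ = fun i => constRow d k (b i)) :
    Matrix.vecMul (fun p => lead P (ξ p.2) p.1) (ncEvalM P X) = fun p => b p.2 p.1 := by
  rw [← evalTuple_constRow X b, ← h, map_sub, evalTuple_eq hP X ξ, add_sub_cancel_right]

lemma stable_companion {l : ℕ} {Q : Fin d → Matrix (Fin l) (Fin l) ℂ} (hP : IsUnit (constMat P))
    (hstable : QStable Q P) : Stable Q (companion P) := by
  intro n X hX ξ hξ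
  rcases n with _ | n
  · exact Subsingleton.elim _ _
  have h0 : (fun p : Fin k × Fin (n + 1) => lead P (ξ p.2) p.1) = 0 := by
    have h1 := vecMul_lead (b := 0) hP X (ξ := ξ) (by
      rw [hξ, sub_self]
      funext i
      simp)
    obtain ⟨u, hu⟩ := hstable n X hX
    have h2 := congrArg (fun v => Matrix.vecMul v
      (↑u⁻¹ : Matrix (Fin k × Fin (n + 1)) (Fin k × Fin (n + 1)) ℂ)) h1
    simp only [← hu, Matrix.vecMul_vecMul, Units.mul_inv, Matrix.vecMul_one] at h2
    rw [h2]
    exact Matrix.zero_vecMul _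
  have hfox : ∀ x i, companion P x (ξ i) = rowFox k x (ξ i) := by
    intro x i
    rw [companion_apply]
    have : ∀ b, lead P (ξ i) b = 0 := fun b => congrFun h0 (b, i)
    simp [this]
  suffices ∀ N, (∀ i, ξ i ∈ degLT d k N) → ξ = 0 by
    choose N hN using fun i => exists_mem_degLT (ξ i)
    exact this (Finset.univ.sup N) fun i => degLT_mono (Finset.le_sup (Finset.mem_univ i)) (hN i)
  intro N
  induction N with
  | zero => exact fun h => funext fun i => mem_degLT_zero.1 (h i)
  | succ N ih =>
    intro h
    refine ih fun i => ?_
    rw [← hξ, ampl_apply]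
    refine Submodule.sum_mem _ fun x _ => Submodule.sum_mem _ fun j _ => Submodule.smul_mem _ _ ?_
    rw [hfox]
    exact mem_degLT_succ.1 (h j) x

lemma isUnit_constMat {l : ℕ} {Q : Fin d → Matrix (Fin l) (Fin l) ℂ}
    (hstable : QStable Q P) : IsUnit (constMat P) := by
  have h0 := hstable 0 (fun _ => 0) (by simp [memBallQ, opNorm])
  have h1 : ncEvalM P (fun _ => (0 : Matrix (Fin 1) (Fin 1) ℂ)) =
      (constMat P).submatrix (Equiv.prodUnique (Fin k) (Fin 1))
        (Equiv.prodUnique (Fin k) (Fin 1)) := by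
    have key : ∀ r : FreeAlgebra ℂ (Fin d),
        ncEval (fun _ => (0 : Matrix (Fin 1) (Fin 1) ℂ)) r = algebraMap ℂ _ (algebraMapInv r) := by
      intro r
      induction r with
      | grade0 c => simp
      | grade1 y => simp [ncEval, algebraMapInv]
      | mul a b ha hb => simp [ha, hb]
      | add a b ha hb => simp [ha, hb]
    ext p q
    simp [ncEvalM, key, constMat, Matrix.algebraMap_matrix_apply, Subsingleton.elim p.2 q.2]
  rw [h1] at h0
  exact (Matrix.isUnit_submatrix_equiv _ _).1 h0

/-- A finite-dimensional space of rows of polynomials invariant under the companion operators and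
containing all constant rows. -/
lemma exists_invariant (P : Matrix (Fin k) (Fin k) (FreeAlgebra ℂ (Fin d))) :
    ∃ U : Submodule ℂ (Fin k → FreeAlgebra ℂ (Fin d)), U.FG ∧ U ≤ pre (companion P) U ∧
      ∀ c, constRow d k c ∈ U := by
  choose N hN using fun a => exists_mem_degLT (P a)
  refine ⟨degLT d k (Finset.univ.sup N + 1), degLT_fg _, fun g hg => mem_pre.2 fun x => ?_,
    fun c => degLT_mono (by lia) (constRow_mem_degLT c)⟩
  rw [companion_apply]
  refine mem_degLT_succ.1 (degLT_mono (Nat.le_succ _) (Submodule.sub_mem _ hg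
    (Submodule.sum_mem _ fun b _ => Submodule.smul_mem _ _ ?_))) x
  exact degLT_mono ((Finset.le_sup (Finset.mem_univ b)).trans (Nat.le_succ _)) (hN b)

end Eval

/-! ### Operator norms -/

section OpNorm

variable {m n : Type*} [Fintype m] [Fintype n]

lemma norm_vecMul_eq (M : Matrix m m ℂ) (v : m → ℂ) (i : m) :
    ‖Matrix.vecMul v M i‖ = ‖Matrix.mulVec Mᴴ (star v) i‖ := by
  rw [← Matrix.star_vecMul, Pi.star_apply, norm_star]

variable [DecidableEq m] [DecidableEq n]

lemma opNorm_nonneg (M : Matrix m m ℂ) : 0 ≤ opNorm M := norm_nonneg _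

lemma opNorm_mul (M N : Matrix m m ℂ) : opNorm (M * N) ≤ opNorm M * opNorm N := by
  open scoped Matrix.Norms.L2Operator in
  exact norm_mul_le M N

lemma opNorm_add (M N : Matrix m m ℂ) : opNorm (M + N) ≤ opNorm M + opNorm N := by
  open scoped Matrix.Norms.L2Operator in
  exact norm_add_le M N

lemma opNorm_sum {α : Type*} (s : Finset α) (M : α → Matrix m m ℂ) :
    opNorm (∑ a ∈ s, M a) ≤ ∑ a ∈ s, opNorm (M a) := by
  open scoped Matrix.Norms.L2Operator in
  exact norm_sum_le s M

lemma opNorm_smul (c : ℂ) (M : Matrix m m ℂ) : opNorm (c • M) = ‖c‖ * opNorm M := by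
  open scoped Matrix.Norms.L2Operator in
  exact norm_smul c M

lemma opNorm_conjTranspose (M : Matrix m m ℂ) : opNorm Mᴴ = opNorm M := by
  open scoped Matrix.Norms.L2Operator in
  exact Matrix.l2_opNorm_conjTranspose M

lemma sum_mulVec_le (M : Matrix m m ℂ) (v : m → ℂ) :
    ∑ i, ‖Matrix.mulVec M v i‖ ^ 2 ≤ opNorm M ^ 2 * ∑ i, ‖v i‖ ^ 2 := by
  have h := (Matrix.toEuclideanCLM (𝕜 := ℂ) M).le_opNorm (WithLp.toLp 2 v)
  have h2 := pow_le_pow_left₀ (norm_nonneg _) h 2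
  rw [mul_pow, EuclideanSpace.norm_sq_eq, EuclideanSpace.norm_sq_eq] at h2
  simpa [opNorm, Matrix.ofLp_toEuclideanCLM] using h2

lemma opNorm_le {M : Matrix m m ℂ} {c : ℝ} (hc : 0 ≤ c)
    (h : ∀ v : m → ℂ, ∑ i, ‖Matrix.mulVec M v i‖ ^ 2 ≤ c ^ 2 * ∑ i, ‖v i‖ ^ 2) :
    opNorm M ≤ c := by
  refine ContinuousLinearMap.opNorm_le_bound _ hc fun v => ?_
  refine le_of_sq_le_sq ?_ (by positivity)
  rw [mul_pow, EuclideanSpace.norm_sq_eq, EuclideanSpace.norm_sq_eq]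
  simpa [Matrix.ofLp_toEuclideanCLM] using h v.ofLp

lemma sum_vecMul_le (M : Matrix m m ℂ) (v : m → ℂ) :
    ∑ i, ‖Matrix.vecMul v M i‖ ^ 2 ≤ opNorm M ^ 2 * ∑ i, ‖v i‖ ^ 2 := by
  have := sum_mulVec_le Mᴴ (star v)
  rw [opNorm_conjTranspose] at this
  simpa [norm_vecMul_eq] using this

lemma opNorm_le_of_vecMul {M : Matrix m m ℂ} {c : ℝ} (hc : 0 ≤ c)
    (h : ∀ v : m → ℂ, ∑ i, ‖Matrix.vecMul v M i‖ ^ 2 ≤ c ^ 2 * ∑ i, ‖v i‖ ^ 2) :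
    opNorm M ≤ c := by
  rw [← opNorm_conjTranspose]
  refine opNorm_le hc fun v => ?_
  simpa [norm_vecMul_eq] using h (star v)

lemma opNorm_one_le : opNorm (1 : Matrix m m ℂ) ≤ 1 :=
  opNorm_le zero_le_one fun v => by simp

lemma opNorm_one_kronecker_le (U : Matrix n n ℂ) :
    opNorm ((1 : Matrix m m ℂ) ⊗ₖ U) ≤ opNorm U := by
  refine opNorm_le (opNorm_nonneg U) fun v => ?_
  have h : ∀ a i, Matrix.mulVec ((1 : Matrix m m ℂ) ⊗ₖ U) v (a, i) =
      Matrix.mulVec U (fun j => v (a, j)) i := by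
    intro a i
    simp [Matrix.mulVec, dotProduct, Fintype.sum_prod_type, Matrix.one_apply]
  simp only [Fintype.sum_prod_type, h, Finset.mul_sum]
  refine Finset.sum_le_sum fun a _ => ?_
  rw [← Finset.mul_sum]
  exact sum_mulVec_le U _

lemma opNorm_single_kronecker_le (a b : m) (M : Matrix n n ℂ) :
    opNorm (Matrix.single a b (1 : ℂ) ⊗ₖ M) ≤ opNorm M := by
  refine opNorm_le (opNorm_nonneg M) fun v => ?_
  have h : ∀ c i, Matrix.mulVec (Matrix.single a b (1 : ℂ) ⊗ₖ M) v (c, i) =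
      if c = a then Matrix.mulVec M (fun j => v (b, j)) i else 0 := by
    intro c i
    simp only [Matrix.mulVec, dotProduct, Fintype.sum_prod_type, Matrix.kroneckerMap_apply,
      Matrix.single_apply]
    split_ifs with hc
    · subst hc
      rw [Finset.sum_eq_single b (fun c' _ hc' => by simp [hc'.symm]) (by simp)]
      simp
    · simp [Ne.symm hc]
  simp only [Fintype.sum_prod_type, h]
  rw [Finset.sum_eq_single a (fun c _ hc => by simp [hc]) (by simp)]
  simp only [if_true]
  refine (sum_mulVec_le M _).trans (mul_le_mul_of_nonneg_left ?_ (sq_nonneg _))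
  exact Finset.single_le_sum (f := fun b => ∑ j, ‖v (b, j)‖ ^ 2)
    (fun _ _ => by positivity) (Finset.mem_univ b)

lemma opNorm_block_le (M : Matrix (m × n) (m × n) ℂ) (a b : m) :
    opNorm (M.submatrix (Prod.mk a) (Prod.mk b)) ≤ opNorm M := by
  refine opNorm_le (opNorm_nonneg M) fun v => ?_
  let w : m × n → ℂ := fun p => if p.1 = b then v p.2 else 0
  have h1 : ∀ i, Matrix.mulVec (M.submatrix (Prod.mk a) (Prod.mk b)) v i =
      Matrix.mulVec M w (a, i) := by
    intro i
    simp only [Matrix.mulVec, dotProduct, Fintype.sum_prod_type, Matrix.submatrix_apply, w]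
    rw [Finset.sum_eq_single b (fun c _ hc => by simp [hc]) (by simp)]
    simp
  have h2 : ∑ p, ‖w p‖ ^ 2 = ∑ i, ‖v i‖ ^ 2 := by
    simp only [Fintype.sum_prod_type, w]
    rw [Finset.sum_eq_single b (fun c _ hc => by simp [hc]) (by simp)]
    simp
  rw [← h2]
  refine le_trans ?_ (sum_mulVec_le M w)
  simp only [h1]
  rw [Fintype.sum_prod_type]
  exact Finset.single_le_sum (f := fun a => ∑ i, ‖Matrix.mulVec M w (a, i)‖ ^ 2)
    (fun _ _ => by positivity) (Finset.mem_univ a)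

end OpNorm

section Ball

variable {d l n : ℕ} {Q : Fin d → Matrix (Fin l) (Fin l) ℂ}

lemma memBallQ_mul {X : Fin d → Matrix (Fin n) (Fin n) ℂ} (hX : memBallQ Q X)
    {U : Matrix (Fin n) (Fin n) ℂ} (hU : opNorm U ≤ 1) : memBallQ Q fun x => X x * U := by
  have : ∑ x, Q x ⊗ₖ (X x * U) = (∑ x, Q x ⊗ₖ X x) * ((1 : Matrix (Fin l) (Fin l) ℂ) ⊗ₖ U) := by
    rw [Finset.sum_mul]
    refine Finset.sum_congr rfl fun x _ => ?_
    rw [← Matrix.mul_kronecker_mul, mul_one]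
  rw [memBallQ, this]
  refine lt_of_le_of_lt ((opNorm_mul _ _).trans ?_) hX
  exact mul_le_of_le_one_right (opNorm_nonneg _) ((opNorm_one_kronecker_le U).trans hU)

lemma memBallQ_smul {X : Fin d → Matrix (Fin n) (Fin n) ℂ} (hX : memBallQ Q X) {c : ℂ}
    (hc : ‖c‖ ≤ 1) : memBallQ Q fun x => c • X x := by
  have : ∑ x, Q x ⊗ₖ (c • X x) = c • ∑ x, Q x ⊗ₖ X x := by
    rw [Finset.smul_sum]
    exact Finset.sum_congr rfl fun x _ => Matrix.kronecker_smul _ _ _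
  rw [memBallQ, this, opNorm_smul]
  exact (mul_le_of_le_one_left (opNorm_nonneg _) hc).trans_lt hX

lemma exists_memBallQ_single (Q : Fin d → Matrix (Fin l) (Fin l) ℂ) (x : Fin d) :
    ∃ ε : ℂ, ε ≠ 0 ∧ memBallQ (n := 1) Q (Pi.single x (ε • 1)) := by
  set M := opNorm (Q x ⊗ₖ (1 : Matrix (Fin 1) (Fin 1) ℂ)) with hM
  have hM0 : 0 ≤ M := opNorm_nonneg _
  refine ⟨((M + 1)⁻¹ : ℝ), Complex.ofReal_ne_zero.2 (inv_ne_zero (by linarith)), ?_⟩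
  rw [memBallQ, Finset.sum_eq_single x (fun y _ hy => by simp [hy]) (by simp), Pi.single_eq_same,
    Matrix.kronecker_smul, opNorm_smul, ← hM, Complex.norm_real, Real.norm_eq_abs,
    abs_of_nonneg (by positivity), inv_mul_lt_iff₀ (by positivity)]
  linarith

/-- The direct sum of two square matrices. -/
def dsum {n₁ n₂ : ℕ} (X : Matrix (Fin n₁) (Fin n₁) ℂ) (Y : Matrix (Fin n₂) (Fin n₂) ℂ) :
    Matrix (Fin (n₁ + n₂)) (Fin (n₁ + n₂)) ℂ :=
  (Matrix.fromBlocks X 0 0 Y).submatrix finSumFinEquiv.symm finSumFinEquiv.symm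

lemma memBallQ_dsum {n₁ n₂ : ℕ} {X : Fin d → Matrix (Fin n₁) (Fin n₁) ℂ}
    {Y : Fin d → Matrix (Fin n₂) (Fin n₂) ℂ} (hX : memBallQ Q X) (hY : memBallQ Q Y) :
    memBallQ Q fun x => dsum (X x) (Y x) := by
  refine lt_of_le_of_lt (opNorm_le (c := max (opNorm (∑ x, Q x ⊗ₖ X x))
    (opNorm (∑ x, Q x ⊗ₖ Y x))) (le_max_of_le_left (opNorm_nonneg _)) fun v => ?_) (max_lt hX hY)
  have h1 : ∀ a i, Matrix.mulVec (∑ x, Q x ⊗ₖ dsum (X x) (Y x)) v (a, Fin.castAdd n₂ i) =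
      Matrix.mulVec (∑ x, Q x ⊗ₖ X x) (fun p => v (p.1, Fin.castAdd n₂ p.2)) (a, i) := by
    intro a i
    simp [Matrix.mulVec, dotProduct, Fintype.sum_prod_type, Matrix.sum_apply, dsum,
      Fin.sum_univ_add]
  have h2 : ∀ a i, Matrix.mulVec (∑ x, Q x ⊗ₖ dsum (X x) (Y x)) v (a, Fin.natAdd n₁ i) =
      Matrix.mulVec (∑ x, Q x ⊗ₖ Y x) (fun p => v (p.1, Fin.natAdd n₁ p.2)) (a, i) := by
    intro a i
    simp [Matrix.mulVec, dotProduct, Fintype.sum_prod_type, Matrix.sum_apply, dsum,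
      Fin.sum_univ_add]
  have e1 := sum_mulVec_le (∑ x, Q x ⊗ₖ X x) (fun p => v (p.1, Fin.castAdd n₂ p.2))
  have e2 := sum_mulVec_le (∑ x, Q x ⊗ₖ Y x) (fun p => v (p.1, Fin.natAdd n₁ p.2))
  simp only [Fintype.sum_prod_type, Fin.sum_univ_add, h1, h2, Finset.sum_add_distrib, mul_add]
  simp only [Fintype.sum_prod_type] at e1 e2
  refine add_le_add (e1.trans ?_) (e2.trans ?_)
  · refine mul_le_mul_of_nonneg_right ?_ (by positivity)
    exact pow_le_pow_left₀ (opNorm_nonneg _) (le_max_left _ _) 2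
  · refine mul_le_mul_of_nonneg_right ?_ (by positivity)
    exact pow_le_pow_left₀ (opNorm_nonneg _) (le_max_right _ _) 2

/-- The coordinates of points of the ball are uniformly bounded. -/
lemma exists_opNorm_coord_le (hQ : LinearIndependent ℂ Q) (x : Fin d) :
    ∃ C : ℝ, 0 ≤ C ∧ ∀ (n : ℕ) (X : Fin d → Matrix (Fin n) (Fin n) ℂ), memBallQ Q X →
      opNorm (X x) ≤ C := by
  obtain ⟨f, hf⟩ : ∃ f : Matrix (Fin l) (Fin l) ℂ →ₗ[ℂ] ℂ,
      ∀ y, f (Q y) = if y = x then 1 else 0 := by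
    obtain ⟨g, hg⟩ := (Fintype.linearCombination ℂ Q).exists_leftInverse_of_injective
      (LinearMap.ker_eq_bot.2 hQ.fintypeLinearCombination_injective)
    refine ⟨LinearMap.proj x ∘ₗ g, fun y => ?_⟩
    have := LinearMap.congr_fun hg (Pi.single y 1)
    rw [LinearMap.comp_apply, Fintype.linearCombination_apply_single, one_smul] at this
    simp [this, Pi.single_apply, eq_comm]
  obtain ⟨c, hc⟩ : ∃ c : Fin l → Fin l → ℂ, ∀ M : Matrix (Fin l) (Fin l) ℂ,
      f M = ∑ a, ∑ b, c a b * M a b := by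
    refine ⟨fun a b => f (Matrix.single a b 1), fun M => ?_⟩
    conv_lhs => rw [Matrix.matrix_eq_sum_single M]
    simp only [map_sum]
    refine Finset.sum_congr rfl fun a _ => Finset.sum_congr rfl fun b _ => ?_
    rw [mul_comm, ← smul_eq_mul, ← map_smul, Matrix.smul_single, smul_eq_mul, mul_one]
  refine ⟨∑ a, ∑ b, ‖c a b‖, by positivity, fun n X hX => ?_⟩
  have hXx : X x = ∑ a, ∑ b, c a b •
      (∑ y, Q y ⊗ₖ X y).submatrix (Prod.mk a) (Prod.mk b) := by
    have h1 : X x = ∑ y, f (Q y) • X y := by simp [hf]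
    rw [h1]
    simp_rw [hc]
    ext i j
    simp only [Matrix.sum_apply, Matrix.smul_apply, Matrix.submatrix_apply, smul_eq_mul,
      Matrix.kroneckerMap_apply, Finset.sum_mul, Finset.mul_sum]
    rw [Finset.sum_comm]
    refine Finset.sum_congr rfl fun a _ => ?_
    rw [Finset.sum_comm]
    exact Finset.sum_congr rfl fun b _ => Finset.sum_congr rfl fun y _ => by ring
  rw [hXx]
  refine (opNorm_sum _ _).trans (Finset.sum_le_sum fun a _ =>
    (opNorm_sum _ _).trans (Finset.sum_le_sum fun b _ => ?_))
  rw [opNorm_smul]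
  exact mul_le_of_le_one_right (norm_nonneg _) ((opNorm_block_le _ a b).trans (le_of_lt hX))

end Ball

/-! ### Contractive renormings of stable tuples -/

section Contraction

variable {m n : Type*} [Fintype m] [Fintype n]

lemma star_dotProduct_self (v : n → ℂ) : star v ⬝ᵥ v = ((∑ i, ‖v i‖ ^ 2 : ℝ) : ℂ) := by
  simp [dotProduct, Complex.conj_mul']

lemma star_dotProduct_mul_conjTranspose (F : Matrix m n ℂ) (v : m → ℂ) :
    star v ⬝ᵥ (F * Fᴴ) *ᵥ v = ((∑ i, ‖(Fᴴ *ᵥ v) i‖ ^ 2 : ℝ) : ℂ) := by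
  rw [← star_dotProduct_self, Matrix.star_mulVec, Matrix.conjTranspose_conjTranspose,
    ← Matrix.mulVec_mulVec, Matrix.dotProduct_mulVec]

lemma sum_norm_sq_le_of_star_dotProduct_eq {p w : n → ℂ} (h : star w ⬝ᵥ p = star p ⬝ᵥ p) :
    ∑ i, ‖p i‖ ^ 2 ≤ ∑ i, ‖w i‖ ^ 2 := by
  have h1 : star p ⬝ᵥ w = star p ⬝ᵥ p := by
    have h2 := congrArg star h
    rw [star_dotProduct_self, Matrix.star_dotProduct, star_star] at h2
    rw [star_dotProduct_self, h2]
    simp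
  have h2 : star (w - p) ⬝ᵥ (w - p) = star w ⬝ᵥ w - star p ⬝ᵥ p := by
    rw [star_sub, sub_dotProduct, dotProduct_sub, dotProduct_sub, h, h1]
    ring
  rw [star_dotProduct_self, star_dotProduct_self, star_dotProduct_self] at h2
  have h3 : ∑ i, ‖(w - p) i‖ ^ 2 = ∑ i, ‖w i‖ ^ 2 - ∑ i, ‖p i‖ ^ 2 := by exact_mod_cast h2
  have h4 : 0 ≤ ∑ i, ‖(w - p) i‖ ^ 2 := by positivity
  linarith

variable [DecidableEq m] [DecidableEq n]

/-- If `E * Eᴴ < F * Fᴴ` then `E` factors through `F` by a contraction. -/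
lemma exists_contraction {E F : Matrix m n ℂ}
    (h : ∀ v : m → ℂ, v ≠ 0 → ∑ i, ‖(Eᴴ *ᵥ v) i‖ ^ 2 < ∑ i, ‖(Fᴴ *ᵥ v) i‖ ^ 2) :
    ∃ U : Matrix n n ℂ, opNorm U ≤ 1 ∧ F * U = E := by
  have hR : IsUnit (F * Fᴴ) := by
    rw [← Matrix.mulVec_injective_iff_isUnit]
    refine (injective_iff_map_eq_zero (Matrix.mulVecLin (F * Fᴴ))).2 fun v hv => ?_
    by_contra hv0
    have h1 := star_dotProduct_mul_conjTranspose F v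
    rw [← Matrix.mulVecLin_apply, hv, dotProduct_zero] at h1
    have h2 : ∑ i, ‖(Fᴴ *ᵥ v) i‖ ^ 2 = 0 := by exact_mod_cast h1.symm
    have h3 := h v hv0
    rw [h2] at h3
    exact absurd h3 (not_lt.2 (by positivity))
  have hR' : IsUnit (F * Fᴴ).det := (Matrix.isUnit_iff_isUnit_det _).1 hR
  have hRH : ((F * Fᴴ)⁻¹)ᴴ = (F * Fᴴ)⁻¹ := by
    rw [Matrix.conjTranspose_nonsing_inv, Matrix.conjTranspose_mul,
      Matrix.conjTranspose_conjTranspose]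
  refine ⟨Fᴴ * (F * Fᴴ)⁻¹ * E, ?_, ?_⟩
  · rw [← opNorm_conjTranspose]
    refine opNorm_le zero_le_one fun w => ?_
    rw [one_pow, one_mul]
    have h1 : (Fᴴ * (F * Fᴴ)⁻¹ * E)ᴴ *ᵥ w = Eᴴ *ᵥ ((F * Fᴴ)⁻¹ *ᵥ (F *ᵥ w)) := by
      simp [Matrix.conjTranspose_mul, hRH, Matrix.mul_assoc]
    have h2 : ∀ v : m → ℂ, ∑ i, ‖(Eᴴ *ᵥ v) i‖ ^ 2 ≤ ∑ i, ‖(Fᴴ *ᵥ v) i‖ ^ 2 := by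
      intro v
      by_cases hv : v = 0
      · simp [hv]
      · exact (h v hv).le
    rw [h1]
    refine (h2 _).trans (sum_norm_sq_le_of_star_dotProduct_eq ?_)
    rw [Matrix.star_mulVec, Matrix.star_mulVec, Matrix.star_mulVec, hRH,
      Matrix.conjTranspose_conjTranspose]
    simp only [Matrix.dotProduct_mulVec, Matrix.vecMul_vecMul, Matrix.mul_assoc]
    congr 2
    rw [← Matrix.mul_assoc F, Matrix.mul_nonsing_inv_cancel_left _ _ hR']
  · rw [← Matrix.mul_assoc, ← Matrix.mul_assoc, Matrix.mul_nonsing_inv _ hR', Matrix.one_mul]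

open scoped ComplexOrder in
/-- A real-linear functional represented by a positive definite form. -/
lemma exists_form (g : Matrix m m ℂ →ₗ[ℂ] ℂ)
    (hg : ∀ v : m → ℂ, 0 ≤ (g (Matrix.vecMulVec v (star v))).re) :
    ∃ S : Matrix m m ℂ, ∀ {n : ℕ} (E : Matrix m (Fin n) ℂ),
      ∑ i, ∑ j, ‖(S * E) i j‖ ^ 2 = 2 * (g (E * Eᴴ)).re := by
  set K : Matrix m m ℂ := Matrix.of fun b a =>
    g (Matrix.single a b 1) + star (g (Matrix.single b a 1)) with hK
  have hKH : K.IsHermitian := by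
    ext a b
    simp [hK, add_comm]
  have htr : ∀ M : Matrix m m ℂ, M.IsHermitian → (K * M).trace = ((2 * (g M).re : ℝ) : ℂ) := by
    intro M hM
    have h1 : g M = ∑ a, ∑ b, g (Matrix.single a b 1) * M a b := by
      conv_lhs => rw [Matrix.matrix_eq_sum_single M]
      simp only [map_sum]
      refine Finset.sum_congr rfl fun a _ => Finset.sum_congr rfl fun b _ => ?_
      rw [mul_comm, ← smul_eq_mul, ← map_smul, Matrix.smul_single, smul_eq_mul, mul_one]
    have h2 : (K * M).trace = g M + star (g M) := by
      have h3 : star (g M) = ∑ a, ∑ b, star (g (Matrix.single b a 1)) * M a b := by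
        rw [h1]
        simp only [star_sum]
        rw [Finset.sum_comm]
        refine Finset.sum_congr rfl fun a _ => Finset.sum_congr rfl fun b _ => ?_
        rw [star_mul', hM.apply]
      rw [h3, h1, ← Finset.sum_add_distrib]
      simp only [← Finset.sum_add_distrib, Matrix.trace, Matrix.diag, Matrix.mul_apply, hK,
        Matrix.of_apply, add_mul]
      rw [Finset.sum_comm]
    rw [h2]
    simpa using Complex.add_conj (g M)
  have hpos : K.PosSemidef := by
    refine Matrix.PosSemidef.of_dotProduct_mulVec_nonneg hKH fun v => ?_
    have h1 : star v ⬝ᵥ K *ᵥ v = (K * Matrix.vecMulVec v (star v)).trace := by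
      rw [Matrix.mul_vecMulVec, Matrix.trace_vecMulVec, dotProduct_comm]
    rw [h1, htr _ (by simp [Matrix.IsHermitian, Matrix.conjTranspose_vecMulVec])]
    exact Complex.zero_le_real.2 (mul_nonneg zero_le_two (hg v))
  obtain ⟨S, hS⟩ : ∃ S : Matrix m m ℂ, K = Sᴴ * S := by
    open scoped MatrixOrder in
    exact CStarAlgebra.nonneg_iff_eq_star_mul_self.1 hpos.nonneg
  refine ⟨S, fun {n} E => ?_⟩
  have h1 : (((2 * (g (E * Eᴴ)).re : ℝ)) : ℂ) = (((S * E)ᴴ * (S * E)).trace) := by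
    rw [← htr _ (Matrix.isHermitian_mul_conjTranspose_self E), hS, Matrix.conjTranspose_mul,
      ← Matrix.mul_assoc, Matrix.trace_mul_comm]
    simp only [Matrix.mul_assoc]
  have h2 : ((S * E)ᴴ * (S * E)).trace = ((∑ i, ∑ j, ‖(S * E) i j‖ ^ 2 : ℝ) : ℂ) := by
    rw [Finset.sum_comm]
    simp only [Matrix.trace, Matrix.diag, Matrix.mul_apply (M := (S * E)ᴴ),
      Matrix.conjTranspose_apply, Complex.star_def, Complex.conj_mul']
    push_cast
    rfl
  exact_mod_cast (h1.trans h2).symm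

end Contraction

section Separation

variable {m : Type*} [Fintype m] [DecidableEq m]

lemma re_star_dotProduct_mulVec_pos {M : Matrix m m ℂ} (hM : opNorm (M - 1) < 1) {v : m → ℂ}
    (hv : v ≠ 0) : 0 < (star v ⬝ᵥ M *ᵥ v).re := by
  have h0 : 0 < ∑ i, ‖v i‖ ^ 2 := by
    obtain ⟨i, hi⟩ := Function.ne_iff.1 hv
    exact Finset.sum_pos' (fun _ _ => by positivity)
      ⟨i, Finset.mem_univ i, pow_pos (norm_pos_iff.2 hi) 2⟩
  have h1 := sum_mulVec_le (M - 1) v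
  have h2 : ∑ i, ‖((M - 1) *ᵥ v) i‖ ^ 2 =
      ∑ i, ‖(M *ᵥ v) i‖ ^ 2 - 2 * (star v ⬝ᵥ M *ᵥ v).re + ∑ i, ‖v i‖ ^ 2 := by
    rw [dotProduct, Complex.re_sum, Finset.mul_sum, ← Finset.sum_sub_distrib,
      ← Finset.sum_add_distrib]
    refine Finset.sum_congr rfl fun i _ => ?_
    simp only [Matrix.sub_mulVec, Matrix.one_mulVec, Pi.sub_apply, ← Complex.normSq_eq_norm_sq,
      Complex.normSq_sub, Pi.star_apply, Complex.star_def]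
    rw [mul_comm (starRingEnd ℂ (v i))]
    ring
  have h3 : opNorm (M - 1) ^ 2 < 1 := pow_lt_one₀ (opNorm_nonneg _) hM two_ne_zero
  have h4 : 0 ≤ ∑ i, ‖(M *ᵥ v) i‖ ^ 2 := by positivity
  nlinarith

lemma continuous_opNorm : Continuous (opNorm : Matrix m m ℂ → ℝ) := by
  open scoped Matrix.Norms.L2Operator in
  exact continuous_norm

/-- A convex cone without positive definite elements is separated from the identity. -/
lemma exists_separating {𝒞 : Set (Matrix m m ℂ)} (hconv : Convex ℝ 𝒞) (h0 : (0 : Matrix m m ℂ) ∈ 𝒞)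
    (hsmul : ∀ t : ℝ, 0 < t → ∀ M ∈ 𝒞, t • M ∈ 𝒞)
    (hpos : ∀ M ∈ 𝒞, ¬ ∀ v : m → ℂ, v ≠ 0 → 0 < (star v ⬝ᵥ M *ᵥ v).re) :
    ∃ g : Matrix m m ℂ →ₗ[ℂ] ℂ, 0 < (g 1).re ∧ ∀ M ∈ 𝒞, (g M).re ≤ 0 := by
  set Pd : Set (Matrix m m ℂ) := {M | ∀ v : m → ℂ, v ≠ 0 → 0 < (star v ⬝ᵥ M *ᵥ v).re} with hpd
  have hconv' : Convex ℝ Pd := by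
    intro M hM N hN a b ha hb hab v hv
    have h1 := hM v hv
    have h2 := hN v hv
    simp only [Matrix.add_mulVec, dotProduct_add, Matrix.smul_mulVec, dotProduct_smul,
      Complex.add_re, Complex.real_smul, Complex.re_ofReal_mul]
    rcases ha.eq_or_lt with rfl | ha
    · have : 0 < b := by linarith
      nlinarith
    · nlinarith [mul_pos ha h1]
  have h1 : (1 : Matrix m m ℂ) ∈ interior Pd := by
    refine mem_interior.2 ⟨{M | opNorm (M - 1) < 1}, fun M hM v hv =>
      re_star_dotProduct_mulVec_pos hM hv, ?_, ?_⟩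
    · exact isOpen_lt (continuous_opNorm.comp (continuous_id.sub continuous_const))
        continuous_const
    · simp [opNorm]
  obtain ⟨f, u, hf1, hf2⟩ := RCLike.geometric_hahn_banach_open (𝕜 := ℂ) hconv'.interior
    isOpen_interior hconv (Set.disjoint_left.2 fun M hM hM' => hpos M hM' (interior_subset hM))
  have hu : u ≤ 0 := by simpa using hf2 0 h0
  refine ⟨-f.toLinearMap, ?_, fun M hM => ?_⟩
  · have := hf1 1 h1
    simp only [LinearMap.neg_apply, Complex.neg_re]
    simp only [RCLike.re_eq_complex_re] at this
    change 0 < - (f 1).re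
    linarith
  · change (- f M).re ≤ 0
    by_contra! h
    rw [Complex.neg_re] at h
    have h2 := hf2 _ (hsmul ((1 - u) / (-(f M).re)) (div_pos (by linarith) h) M hM)
    rw [← Complex.coe_smul, map_smul] at h2
    simp only [RCLike.re_eq_complex_re, smul_eq_mul, Complex.re_ofReal_mul] at h2
    rw [div_mul_eq_mul_div, le_div_iff₀ h] at h2
    nlinarith

end Separation

section MatrixContraction

variable {d l m : ℕ} {Q : Fin d → Matrix (Fin l) (Fin l) ℂ}

/-- A stable matrix tuple is contractive for a suitable seminorm. -/
lemma exists_seminorm_matrix (hm : 0 < m) (A : Fin d → Matrix (Fin m) (Fin m) ℂ)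
    (hA : ∀ (n : ℕ) (X : Fin d → Matrix (Fin n) (Fin n) ℂ), memBallQ Q X →
      ∀ E : Matrix (Fin m) (Fin n) ℂ, ∑ x, A x * E * X x = E → E = 0) :
    ∃ S : Matrix (Fin m) (Fin m) ℂ, S ≠ 0 ∧
      ∀ (n : ℕ) (X : Fin d → Matrix (Fin n) (Fin n) ℂ), memBallQ Q X →
        ∀ E : Matrix (Fin m) (Fin n) ℂ,
          ∑ i, ∑ j, ‖(S * ∑ x, A x * E * X x) i j‖ ^ 2 ≤ ∑ i, ∑ j, ‖(S * E) i j‖ ^ 2 := by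
  let 𝒞 : Set (Matrix (Fin m) (Fin m) ℂ) := {M | ∃ (n : ℕ) (X : Fin d → Matrix (Fin n) (Fin n) ℂ)
    (E : Matrix (Fin m) (Fin n) ℂ), memBallQ Q X ∧
      M = (∑ x, A x * E * X x) * (∑ x, A x * E * X x)ᴴ - E * Eᴴ}
  have hball0 : ∀ n, memBallQ (n := n) Q 0 := fun n => by simp [memBallQ, opNorm]
  have hadd : ∀ M ∈ 𝒞, ∀ N ∈ 𝒞, M + N ∈ 𝒞 := by
    rintro _ ⟨n₁, X₁, E₁, h₁, rfl⟩ _ ⟨n₂, X₂, E₂, h₂, rfl⟩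
    have key : ∀ F₁ : Matrix (Fin m) (Fin n₁) ℂ, ∀ F₂ : Matrix (Fin m) (Fin n₂) ℂ,
        (Matrix.fromCols F₁ F₂).submatrix id finSumFinEquiv.symm *
          ((Matrix.fromCols F₁ F₂).submatrix id finSumFinEquiv.symm)ᴴ = F₁ * F₁ᴴ + F₂ * F₂ᴴ := by
      intro F₁ F₂
      rw [Matrix.conjTranspose_submatrix, Matrix.submatrix_mul_equiv,
        Matrix.conjTranspose_fromCols_eq_fromRows_conjTranspose, Matrix.fromCols_mul_fromRows,
        Matrix.submatrix_id_id]
    refine ⟨n₁ + n₂, _, (Matrix.fromCols E₁ E₂).submatrix id finSumFinEquiv.symm,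
      memBallQ_dsum h₁ h₂, ?_⟩
    have h3 : ∑ x, A x * (Matrix.fromCols E₁ E₂).submatrix id finSumFinEquiv.symm *
        dsum (X₁ x) (X₂ x) = (Matrix.fromCols (∑ x, A x * E₁ * X₁ x)
          (∑ x, A x * E₂ * X₂ x)).submatrix id finSumFinEquiv.symm := by
      have h4 : ∀ x, A x * (Matrix.fromCols E₁ E₂).submatrix id finSumFinEquiv.symm *
          dsum (X₁ x) (X₂ x) = (Matrix.fromCols (A x * E₁ * X₁ x)
            (A x * E₂ * X₂ x)).submatrix id finSumFinEquiv.symm := by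
        intro x
        have h5 : A x * (Matrix.fromCols E₁ E₂).submatrix id finSumFinEquiv.symm =
            (Matrix.fromCols (A x * E₁) (A x * E₂)).submatrix id finSumFinEquiv.symm := by
          rw [← Matrix.mul_fromCols]
          rfl
        rw [h5, dsum, Matrix.submatrix_mul_equiv, Matrix.fromCols_mul_fromBlocks]
        simp
      simp only [h4]
      ext i j
      rcases h : finSumFinEquiv.symm j with j' | j' <;> simp [Matrix.sum_apply, h]
    rw [h3, key, key]
    abel
  have hsmul : ∀ t : ℝ, 0 ≤ t → ∀ M ∈ 𝒞, t • M ∈ 𝒞 := by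
    rintro t ht _ ⟨n, X, E, h, rfl⟩
    refine ⟨n, X, √t • E, h, ?_⟩
    have h1 : ∀ F : Matrix (Fin m) (Fin n) ℂ, (√t • F) * (√t • F)ᴴ = t • (F * Fᴴ) := by
      intro F
      rw [Matrix.conjTranspose_smul, Matrix.smul_mul, Matrix.mul_smul, smul_smul, star_trivial,
        Real.mul_self_sqrt ht]
    have h2 : ∑ x, A x * (√t • E) * X x = √t • ∑ x, A x * E * X x := by
      simp [Finset.smul_sum]
    rw [h2, h1, h1, smul_sub]
  have hconv : Convex ℝ 𝒞 := fun M hM N hN a b ha hb _ =>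
    hadd _ (hsmul a ha M hM) _ (hsmul b hb N hN)
  have hpos : ∀ M ∈ 𝒞, ¬ ∀ v : Fin m → ℂ, v ≠ 0 → 0 < (star v ⬝ᵥ M *ᵥ v).re := by
    rintro _ ⟨n, X, E, h, rfl⟩ hv
    have hlt : ∀ v : Fin m → ℂ, v ≠ 0 → ∑ i, ‖(Eᴴ *ᵥ v) i‖ ^ 2 <
        ∑ i, ‖((∑ x, A x * E * X x)ᴴ *ᵥ v) i‖ ^ 2 := by
      intro v hv0
      have := hv v hv0
      rw [Matrix.sub_mulVec, dotProduct_sub, star_dotProduct_mul_conjTranspose,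
        star_dotProduct_mul_conjTranspose, Complex.sub_re, Complex.ofReal_re,
        Complex.ofReal_re] at this
      linarith
    obtain ⟨U, hU, hFU⟩ := exists_contraction hlt
    have hE : E = 0 := hA n _ (memBallQ_mul h hU) E (by
      conv_rhs => rw [← hFU]
      simp only [Matrix.sum_mul, Matrix.mul_assoc])
    have := hlt (fun _ => 1) (fun h => one_ne_zero (congrFun h ⟨0, hm⟩))
    simp [hE] at this
  obtain ⟨g, hg1, hg⟩ := exists_separating hconv ⟨0, 0, 0, hball0 0, by simp⟩
    (fun t ht => hsmul t ht.le) hpos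
  obtain ⟨S, hS⟩ := exists_form g fun v => by
    have := hg (-Matrix.vecMulVec v (star v)) ⟨1, 0, Matrix.replicateCol (Fin 1) v, hball0 1, by
      ext i j
      simp [Matrix.vecMulVec_apply, Matrix.mul_apply]⟩
    simpa using this
  refine ⟨S, ?_, fun n X hX E => ?_⟩
  · rintro rfl
    have := hS (1 : Matrix (Fin m) (Fin m) ℂ)
    simp at this
    exact hg1.ne' this
  · rw [hS, hS]
    have := hg _ ⟨n, X, E, hX, rfl⟩
    rw [map_sub, Complex.sub_re] at this
    linarith

end MatrixContraction

/-- A stable tuple of operators is contractive for a suitable nonzero Hilbertian seminorm. -/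
lemma Stable.exists_seminorm {d l : ℕ} {Q : Fin d → Matrix (Fin l) (Fin l) ℂ} {V : Type*}
    [AddCommGroup V] [Module ℂ V] [FiniteDimensional ℂ V] [Nontrivial V]
    {A : Fin d → Module.End ℂ V} (hA : Stable Q A) :
    ∃ (m : ℕ) (S : V →ₗ[ℂ] EuclideanSpace ℂ (Fin m)), S ≠ 0 ∧
      ∀ (n : ℕ) (X : Fin d → Matrix (Fin n) (Fin n) ℂ), memBallQ Q X → ∀ ξ : Fin n → V,
        ∑ i, ‖S (ampl A X ξ i)‖ ^ 2 ≤ ∑ i, ‖S (ξ i)‖ ^ 2 := by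
  classical
  let b := Module.finBasis ℂ V
  set m := Module.finrank ℂ V with hm
  have hm0 : 0 < m := Module.finrank_pos
  let coordM : ∀ {n : ℕ}, (Fin n → V) → Matrix (Fin m) (Fin n) ℂ := fun ξ =>
    Matrix.of fun a i => b.repr (ξ i) a
  have hampl : ∀ {n : ℕ} (X : Fin d → Matrix (Fin n) (Fin n) ℂ) (ξ : Fin n → V),
      coordM (ampl A X ξ) = ∑ x, LinearMap.toMatrix b b (A x) * coordM ξ * X x := by
    intro n X ξ
    ext a i
    simp only [coordM, Matrix.of_apply, ampl_apply, map_sum, map_smul, Finsupp.coe_finsetSum,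
      Finset.sum_apply, Finsupp.smul_apply, smul_eq_mul, Matrix.sum_apply]
    refine Finset.sum_congr rfl fun x _ => ?_
    rw [Matrix.mul_apply]
    refine Finset.sum_congr rfl fun j _ => ?_
    rw [mul_comm, ← LinearMap.toMatrix_mulVec_repr b b]
    rfl
  obtain ⟨S, hS0, hS⟩ := exists_seminorm_matrix (Q := Q) hm0
    (fun x => LinearMap.toMatrix b b (A x)) (by
      intro n X hX E hE
      let ξ : Fin n → V := fun i => b.equivFun.symm fun a => E a i
      have hξ : coordM ξ = E := by
        ext a i
        exact congrFun (b.equivFun.apply_symm_apply fun a => E a i) a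
      have h1 : ampl A X ξ = ξ := by
        funext i
        apply b.repr.injective
        ext a
        have h2 : coordM (ampl A X ξ) = coordM ξ := by rw [hampl, hξ, hE]
        exact congrFun (congrFun h2 a) i
      rw [← hξ, hA n X hX ξ h1]
      ext a i
      simp [coordM])
  let S' : V →ₗ[ℂ] EuclideanSpace ℂ (Fin m) :=
    (WithLp.linearEquiv 2 ℂ (Fin m → ℂ)).symm.toLinearMap ∘ₗ Matrix.mulVecLin S ∘ₗ
      b.equivFun.toLinearMap
  have hS' : ∀ {n : ℕ} (ξ : Fin n → V),
      ∑ i, ‖S' (ξ i)‖ ^ 2 = ∑ i, ∑ j, ‖(S * coordM ξ) i j‖ ^ 2 := by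
    intro n ξ
    rw [Finset.sum_comm]
    refine Finset.sum_congr rfl fun i _ => ?_
    rw [EuclideanSpace.norm_sq_eq]
    rfl
  refine ⟨m, S', ?_, fun n X hX ξ => ?_⟩
  · intro h
    refine hS0 (Matrix.ext_of_mulVec_single fun i => ?_)
    have h1 := LinearMap.congr_fun h (b i)
    simp only [S', LinearMap.comp_apply, LinearEquiv.coe_coe, LinearMap.zero_apply,
      LinearEquiv.map_eq_zero_iff] at h1
    have h2 : b.equivFun (b i) = Pi.single i 1 := by
      funext j
      simp [b.equivFun_self, Pi.single_apply, eq_comm]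
    rwa [h2, Matrix.mulVecLin_apply, ← Matrix.zero_mulVec (Pi.single i 1)] at h1
  · rw [hS', hS', hampl]
    exact hS n X hX _

/-! ### The resolvent estimate -/

section TupleNorm

variable {n : ℕ} {V V₂ : Type*} [NormedAddCommGroup V] [NormedAddCommGroup V₂]

/-- The Hilbertian norm of a tuple of vectors. -/
def tupleNorm (ξ : Fin n → V) : ℝ := ‖(WithLp.toLp 2 ξ : PiLp 2 fun _ : Fin n => V)‖

lemma tupleNorm_nonneg (ξ : Fin n → V) : 0 ≤ tupleNorm ξ := norm_nonneg _

lemma tupleNorm_sq (ξ : Fin n → V) : tupleNorm ξ ^ 2 = ∑ i, ‖ξ i‖ ^ 2 :=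
  PiLp.norm_sq_eq_of_L2 (fun _ : Fin n => V) _

lemma tupleNorm_add (ξ η : Fin n → V) : tupleNorm (ξ + η) ≤ tupleNorm ξ + tupleNorm η :=
  norm_add_le (WithLp.toLp 2 ξ : PiLp 2 fun _ : Fin n => V) (WithLp.toLp 2 η)

lemma tupleNorm_sub (ξ η : Fin n → V) : tupleNorm (ξ - η) ≤ tupleNorm ξ + tupleNorm η :=
  norm_sub_le (WithLp.toLp 2 ξ : PiLp 2 fun _ : Fin n => V) (WithLp.toLp 2 η)

lemma tupleNorm_sum {α : Type*} (s : Finset α) (ξ : α → Fin n → V) :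
    tupleNorm (∑ a ∈ s, ξ a) ≤ ∑ a ∈ s, tupleNorm (ξ a) := by
  induction s using Finset.cons_induction with
  | empty => simp [tupleNorm]
  | cons a s ha ih =>
    rw [Finset.sum_cons, Finset.sum_cons]
    exact (tupleNorm_add _ _).trans (add_le_add_right ih _)

variable [NormedSpace ℂ V] [NormedSpace ℂ V₂]

lemma tupleNorm_smul (c : ℂ) (ξ : Fin n → V) : tupleNorm (c • ξ) = ‖c‖ * tupleNorm ξ :=
  norm_smul c (WithLp.toLp 2 ξ : PiLp 2 fun _ : Fin n => V)

lemma exists_tupleNorm_map_le [FiniteDimensional ℂ V] (L : V →ₗ[ℂ] V₂) :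
    ∃ c : ℝ, 0 ≤ c ∧ ∀ (n : ℕ) (ξ : Fin n → V),
      tupleNorm (fun i => L (ξ i)) ≤ c * tupleNorm ξ := by
  refine ⟨‖L.toContinuousLinearMap‖, norm_nonneg _, fun n ξ => ?_⟩
  refine le_of_sq_le_sq ?_ (mul_nonneg (norm_nonneg _) (tupleNorm_nonneg _))
  rw [mul_pow, tupleNorm_sq, tupleNorm_sq, Finset.mul_sum]
  refine Finset.sum_le_sum fun i _ => ?_
  rw [← mul_pow]
  exact pow_le_pow_left₀ (norm_nonneg _) (L.toContinuousLinearMap.le_opNorm (ξ i)) 2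

lemma tupleNorm_mul_le {m : ℕ} (M : Matrix (Fin n) (Fin n) ℂ)
    (ξ : Fin n → EuclideanSpace ℂ (Fin m)) :
    tupleNorm (fun i => ∑ j, M j i • ξ j) ≤ opNorm M * tupleNorm ξ := by
  refine le_of_sq_le_sq ?_ (mul_nonneg (opNorm_nonneg _) (tupleNorm_nonneg _))
  rw [mul_pow, tupleNorm_sq, tupleNorm_sq]
  simp only [EuclideanSpace.norm_sq_eq]
  rw [Finset.sum_comm, Finset.sum_comm (s := Finset.univ (α := Fin n)), Finset.mul_sum]
  refine Finset.sum_le_sum fun a _ => ?_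
  refine le_trans (le_of_eq ?_) (sum_vecMul_le M fun j => ξ j a)
  refine Finset.sum_congr rfl fun i _ => ?_
  simp [Matrix.vecMul, dotProduct, mul_comm]

lemma exists_tupleNorm_ampl_le {d l m : ℕ} {Q : Fin d → Matrix (Fin l) (Fin l) ℂ}
    (hQ : LinearIndependent ℂ Q) (A : Fin d → Module.End ℂ (EuclideanSpace ℂ (Fin m))) :
    ∃ c : ℝ, 0 ≤ c ∧ ∀ (n : ℕ) (X : Fin d → Matrix (Fin n) (Fin n) ℂ), memBallQ Q X →
      ∀ ξ, tupleNorm (ampl A X ξ) ≤ c * tupleNorm ξ := by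
  choose c hc0 hc using fun x => exists_opNorm_coord_le hQ x
  choose e he0 he using fun x => exists_tupleNorm_map_le (A x)
  refine ⟨∑ x, e x * c x, Finset.sum_nonneg fun x _ => mul_nonneg (he0 x) (hc0 x),
    fun n X hX ξ => ?_⟩
  have h1 : ampl A X ξ = ∑ x, fun i => A x (∑ j, X x j i • ξ j) := by
    funext i
    simp [ampl_apply]
  rw [h1, Finset.sum_mul]
  refine (tupleNorm_sum _ _).trans (Finset.sum_le_sum fun x _ => (he x n _).trans ?_)
  rw [mul_assoc]
  exact mul_le_mul_of_nonneg_left ((tupleNorm_mul_le _ _).trans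
    (mul_le_mul_of_nonneg_right (hc x n X hX) (tupleNorm_nonneg _))) (he0 x)

lemma tupleNorm_pow_le {t : Module.End ℂ (Fin n → V)} {c : ℝ} (hc : 0 ≤ c)
    (ht : ∀ ξ, tupleNorm (t ξ) ≤ c * tupleNorm ξ) (N : ℕ) (ξ : Fin n → V) :
    tupleNorm ((t ^ N) ξ) ≤ c ^ N * tupleNorm ξ := by
  induction N with
  | zero => simp
  | succ N ih =>
    rw [pow_succ', pow_succ', mul_assoc]
    exact (ht _).trans (mul_le_mul_of_nonneg_left ih hc)

lemma tupleNorm_sub_pow_le {t : Module.End ℂ (Fin n → V)} {c : ℝ} (hc : 0 ≤ c)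
    (ht : ∀ ξ, tupleNorm (t ξ) ≤ c * tupleNorm ξ) (N : ℕ) {ξ η : Fin n → V} (h : ξ - t ξ = η) :
    tupleNorm (ξ - (t ^ N) ξ) ≤ (∑ j ∈ Finset.range N, c ^ j) * tupleNorm η := by
  have h1 : ξ - (t ^ N) ξ = ∑ j ∈ Finset.range N, (t ^ j) η := by
    have := LinearMap.congr_fun (geom_sum_mul_neg t N) ξ
    rw [Module.End.mul_apply] at this
    simp only [LinearMap.sub_apply, Module.End.one_apply, h, LinearMap.sum_apply] at this
    exact this.symm
  rw [h1, Finset.sum_mul]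
  exact (tupleNorm_sum _ _).trans (Finset.sum_le_sum fun j _ => tupleNorm_pow_le hc ht j η)

end TupleNorm

section Resolvent

variable {d l m : ℕ} {Q : Fin d → Matrix (Fin l) (Fin l) ℂ}

lemma exists_pseudoinverse {V V₂ : Type*} [AddCommGroup V] [Module ℂ V] [AddCommGroup V₂]
    [Module ℂ V₂] (S : V →ₗ[ℂ] V₂) : ∃ L : V₂ →ₗ[ℂ] V, ∀ v, S (L (S v)) = S v := by
  obtain ⟨g, hg⟩ := S.rangeRestrict.exists_rightInverse_of_surjective S.range_rangeRestrict
  obtain ⟨L, hL⟩ := LinearMap.exists_extend g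
  refine ⟨L, fun v => ?_⟩
  have h1 : L (S v) = g (S.rangeRestrict v) := LinearMap.congr_fun hL (S.rangeRestrict v)
  rw [h1]
  exact congrArg Subtype.val (LinearMap.congr_fun hg (S.rangeRestrict v))

/-- A stable tuple that is not nilpotent, but all of whose invariant subspaces are nilpotent or
conilpotent, is up to nilpotent parts contractive for a nonzero seminorm. -/
lemma Stable.exists_contractive_subspace {V : Type*} [AddCommGroup V] [Module ℂ V]
    [FiniteDimensional ℂ V] {A : Fin d → Module.End ℂ V} (hA : Stable Q A)
    (hdich : ∀ W, W ≤ pre A W →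
      (∃ N, W ≤ (pre A)^[N] ⊥) ∨ ∃ N, ⊤ ≤ (pre A)^[N] W) :
    ∃ (W K : Submodule ℂ V) (N N' m' : ℕ) (S : V →ₗ[ℂ] EuclideanSpace ℂ (Fin m'))
      (J : EuclideanSpace ℂ (Fin m') →ₗ[ℂ] V), ⊤ ≤ (pre A)^[N] W ∧ K ≤ (pre A)^[N'] ⊥ ∧
        W ≤ pre A W ∧ (∀ v ∈ W, v - J (S v) ∈ K) ∧
        ∀ (n : ℕ) (X : Fin d → Matrix (Fin n) (Fin n) ℂ), memBallQ Q X → ∀ ξ : Fin n → V,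
          (∀ i, ξ i ∈ W) → ∑ i, ‖S (ampl A X ξ i)‖ ^ 2 ≤ ∑ i, ‖S (ξ i)‖ ^ 2 := by
  by_cases hnil : ∃ N, (⊤ : Submodule ℂ V) ≤ (pre A)^[N] ⊥
  · obtain ⟨N, hN⟩ := hnil
    exact ⟨⊥, ⊥, N, 0, 0, 0, 0, hN, le_rfl, bot_le, by simp, by simp⟩
  obtain ⟨W, ⟨hW, hWnil⟩, hmin⟩ := exists_minimal_of_wellFoundedLT
    (fun W : Submodule ℂ V => W ≤ pre A W ∧ ¬ ∃ N, W ≤ (pre A)^[N] ⊥)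
    ⟨⊤, fun _ _ => mem_pre.2 fun _ => trivial, hnil⟩
  obtain ⟨N, hN⟩ := (hdich W hW).resolve_left hWnil
  let A' : Fin d → Module.End ℂ W := fun x =>
    (A x).restrict fun v hv => mem_pre.1 (hW hv) x
  have hAA' : ∀ x v, W.subtype (A' x v) = A x (W.subtype v) := fun _ _ => rfl
  have hA' : Stable Q A' := hA.of_injective W.subtype hAA' W.injective_subtype
  have hne : W ≠ ⊥ := by
    rintro rfl
    exact hWnil ⟨0, bot_le⟩
  have : Nontrivial W := Submodule.nontrivial_iff_ne_bot.2 hne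
  obtain ⟨m', S, hS0, hS⟩ := hA'.exists_seminorm
  obtain ⟨L, hL⟩ := exists_pseudoinverse S
  obtain ⟨S', hS'⟩ := LinearMap.exists_extend S
  have hSS' : ∀ v : W, S' v = S v := fun v => LinearMap.congr_fun hS' v
  obtain ⟨N', hN'⟩ : ∃ N', (LinearMap.ker S).map W.subtype ≤ (pre A)^[N'] ⊥ := by
    by_contra hK
    have h1 : W ≤ (LinearMap.ker S).map W.subtype := by
      refine hmin ⟨?_, hK⟩ (Submodule.map_subtype_le _ _)
      rintro _ ⟨v, hv, rfl⟩
      refine mem_pre.2 fun x => ⟨A' x v, ?_, rfl⟩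
      obtain ⟨ε, hε, hball⟩ := exists_memBallQ_single Q x
      have h2 := hS 1 _ hball fun _ => v
      have h3 : ampl A' (Pi.single x (ε • (1 : Matrix (Fin 1) (Fin 1) ℂ))) (fun _ => v) 0 =
          ε • A' x v := by
        rw [ampl_apply, Finset.sum_eq_single x (fun y _ hy => by simp [hy]) (by simp)]
        simp
      have hv' : S v = 0 := hv
      simp only [Fin.sum_univ_one, h3, hv', map_smul] at h2
      simpa [hε] using h2
    refine hS0 (LinearMap.ext fun v => ?_)
    obtain ⟨w, hw, hwv⟩ := h1 v.2
    rw [← W.injective_subtype hwv]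
    exact hw
  refine ⟨W, _, N, N', m', S', W.subtype ∘ₗ L, hN, hN', hW, fun v hv => ?_, fun n X hX ξ hξ => ?_⟩
  · refine ⟨⟨v, hv⟩ - L (S ⟨v, hv⟩), ?_, ?_⟩
    · simp [hL]
    · simp [← hSS']
  · have h1 := hS n X hX fun i => ⟨ξ i, hξ i⟩
    have h2 := ampl_map W.subtype hAA' X fun i => ⟨ξ i, hξ i⟩
    simp only [← hSS'] at h1
    have h3 : ∀ i, ((ampl A' X fun i => ⟨ξ i, hξ i⟩) i : V) = ampl A X ξ i := congrFun h2
    simpa only [h3] using h1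

/-- The resolvent of a stable tuple all of whose invariant subspaces are nilpotent or conilpotent
has a simple pole at worst. -/
lemma Stable.exists_resolvent_le (hQ : LinearIndependent ℂ Q)
    {A : Fin d → Module.End ℂ (EuclideanSpace ℂ (Fin m))} (hA : Stable Q A)
    (hdich : ∀ W, W ≤ pre A W →
      (∃ N, W ≤ (pre A)^[N] ⊥) ∨ ∃ N, ⊤ ≤ (pre A)^[N] W) :
    ∃ C : ℝ, 0 ≤ C ∧ ∀ r : ℝ, 0 ≤ r → r < 1 →
      ∀ (n : ℕ) (X : Fin d → Matrix (Fin n) (Fin n) ℂ), memBallQ Q X →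
        ∀ ξ η : Fin n → EuclideanSpace ℂ (Fin m), ξ - ampl A (fun x => (r : ℂ) • X x) ξ = η →
          tupleNorm ξ ≤ C / (1 - r) * tupleNorm η := by
  obtain ⟨W, K, N, N', m', S, J, hN, hN', hW, hJ, hS⟩ := hA.exists_contractive_subspace hdich
  obtain ⟨c, hc0, hc⟩ := exists_tupleNorm_ampl_le hQ A
  obtain ⟨s, hs0, hs⟩ := exists_tupleNorm_map_le S
  obtain ⟨j, hj0, hj⟩ := exists_tupleNorm_map_le J
  set G : ℝ := ∑ i ∈ Finset.range N, c ^ i with hG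
  set G' : ℝ := ∑ i ∈ Finset.range N', c ^ i with hG'
  have hG0 : 0 ≤ G := by positivity
  have hG0' : 0 ≤ G' := by positivity
  refine ⟨G + G' * c ^ N + (G' * (1 + c) + 1) * (j * (s * c ^ N)), by positivity,
    fun r hr0 hr1 n X hX ξ η hξ => ?_⟩
  have hX' : memBallQ Q fun x => (r : ℂ) • X x :=
    memBallQ_smul hX (by rw [Complex.norm_real, Real.norm_of_nonneg hr0]; exact hr1.le)
  set t := ampl A fun x => (r : ℂ) • X x with ht
  have htc : ∀ ξ, tupleNorm (t ξ) ≤ c * tupleNorm ξ := hc n _ hX'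
  have hr : 0 < 1 - r := by linarith
  set ξ₂ := (t ^ N) ξ with hξ₂
  have hcomm : ∀ v, (t ^ N) (t v) = t ((t ^ N) v) := fun v => by
    rw [← Module.End.mul_apply, ← Module.End.mul_apply, ← pow_succ, ← pow_succ']
  have hη₂ : ξ₂ - t ξ₂ = (t ^ N) η := by rw [← hξ, map_sub, hcomm]
  have hη₂n : tupleNorm ((t ^ N) η) ≤ c ^ N * tupleNorm η := tupleNorm_pow_le hc0 htc N η
  have hmem : ∀ i, ξ₂ i ∈ W := ampl_iterate_mem _ fun i => hN trivial
  -- the contractive part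
  have hα : tupleNorm (fun i => S (ξ₂ i)) ≤ s * c ^ N * tupleNorm η / (1 - r) := by
    have h1 : tupleNorm (fun i => S (t ξ₂ i)) ≤ r * tupleNorm (fun i => S (ξ₂ i)) := by
      have h2 : (fun i => S (t ξ₂ i)) = (r : ℂ) • fun i => S (ampl A X ξ₂ i) := by
        funext i
        rw [ht, ampl_smul, LinearMap.smul_apply, Pi.smul_apply, map_smul]
        rfl
      rw [h2, tupleNorm_smul, Complex.norm_real, Real.norm_of_nonneg hr0]
      refine mul_le_mul_of_nonneg_left (le_of_sq_le_sq ?_ (tupleNorm_nonneg _)) hr0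
      rw [tupleNorm_sq, tupleNorm_sq]
      exact hS n X hX ξ₂ hmem
    have h3 : (fun i => S (ξ₂ i)) = (fun i => S ((t ^ N) η i)) + fun i => S (t ξ₂ i) := by
      funext i
      rw [← hη₂]
      simp
    have h4 := tupleNorm_add (fun i => S ((t ^ N) η i)) fun i => S (t ξ₂ i)
    rw [← h3] at h4
    have h5 := (hs n ((t ^ N) η)).trans (mul_le_mul_of_nonneg_left hη₂n hs0)
    rw [le_div_iff₀ hr]
    linarith
  set ζ : Fin n → EuclideanSpace ℂ (Fin m) := fun i => J (S (ξ₂ i)) with hζ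
  have hζn : tupleNorm ζ ≤ j * (s * c ^ N * tupleNorm η / (1 - r)) :=
    (hj n _).trans (mul_le_mul_of_nonneg_left hα hj0)
  -- the nilpotent part
  have hω : tupleNorm (ξ₂ - ζ) ≤ G' * (c ^ N * tupleNorm η + (1 + c) * tupleNorm ζ) := by
    have h1 : (t ^ N') (ξ₂ - ζ) = 0 := funext fun i =>
      (Submodule.mem_bot ℂ).1 (ampl_iterate_mem _ (fun i => hN' (hJ _ (hmem i))) i)
    have h2 := tupleNorm_sub_pow_le hc0 htc N' (ξ := ξ₂ - ζ) rfl
    rw [h1, sub_zero] at h2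
    refine h2.trans (mul_le_mul_of_nonneg_left ?_ hG0')
    have h3 : ξ₂ - ζ - t (ξ₂ - ζ) = (t ^ N) η - (ζ - t ζ) := by
      rw [← hη₂, map_sub]
      abel
    rw [h3]
    refine (tupleNorm_sub _ _).trans (add_le_add hη₂n ((tupleNorm_sub _ _).trans ?_))
    rw [add_mul, one_mul]
    exact add_le_add_right (htc ζ) _
  have h1 := tupleNorm_sub_pow_le hc0 htc N hξ
  have h2 : ξ = (ξ - ξ₂) + ((ξ₂ - ζ) + ζ) := by abel
  have h3 : tupleNorm ξ ≤ G * tupleNorm η + (G' * (c ^ N * tupleNorm η +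
      (1 + c) * tupleNorm ζ) + tupleNorm ζ) := by
    conv_lhs => rw [h2]
    exact (tupleNorm_add _ _).trans (add_le_add h1 ((tupleNorm_add _ _).trans
      (add_le_add_left hω _)))
  have h4 : tupleNorm η ≤ tupleNorm η / (1 - r) :=
    le_div_self (tupleNorm_nonneg _) hr (by linarith)
  have h5 : (G + G' * c ^ N) * tupleNorm η ≤ (G + G' * c ^ N) * (tupleNorm η / (1 - r)) :=
    mul_le_mul_of_nonneg_left h4 (by positivity)
  have h6 : (G' * (1 + c) + 1) * tupleNorm ζ ≤
      (G' * (1 + c) + 1) * (j * (s * c ^ N * tupleNorm η / (1 - r))) :=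
    mul_le_mul_of_nonneg_left hζn (by positivity)
  calc tupleNorm ξ ≤ (G + G' * c ^ N) * tupleNorm η + (G' * (1 + c) + 1) * tupleNorm ζ := by
        linarith
    _ ≤ _ := add_le_add h5 h6
    _ = _ := by ring

end Resolvent

/-! ### Uniform bounds for polynomials -/

section Polynomial

variable {d l : ℕ} {Q : Fin d → Matrix (Fin l) (Fin l) ℂ}

lemma memBallQ_ofReal_smul {n : ℕ} {X : Fin d → Matrix (Fin n) (Fin n) ℂ} (hX : memBallQ Q X)
    {r : ℝ} (hr0 : 0 ≤ r) (hr1 : r < 1) : memBallQ Q fun x => (r : ℂ) • X x :=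
  memBallQ_smul hX (by rw [Complex.norm_real, Real.norm_of_nonneg hr0]; exact hr1.le)

/-- Polynomials are bounded and Lipschitz along rays of the operator ball. -/
lemma exists_opNorm_ncEval_le (hQ : LinearIndependent ℂ Q) (p : FreeAlgebra ℂ (Fin d)) :
    ∃ C : ℝ, 0 ≤ C ∧ ∀ (n : ℕ) (X : Fin d → Matrix (Fin n) (Fin n) ℂ), memBallQ Q X →
      opNorm (ncEval X p) ≤ C ∧ ∀ r : ℝ, 0 ≤ r → r < 1 →
        opNorm (ncEval X p - ncEval (fun x => (r : ℂ) • X x) p) ≤ C * (1 - r) := by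
  induction p with
  | grade0 c =>
    refine ⟨‖c‖, norm_nonneg c, fun n X _ => ⟨?_, fun r _ hr1 => ?_⟩⟩
    · rw [AlgHom.commutes, Algebra.algebraMap_eq_smul_one, opNorm_smul]
      exact mul_le_of_le_one_right (norm_nonneg c) opNorm_one_le
    · rw [AlgHom.commutes, AlgHom.commutes, sub_self]
      simpa [opNorm] using mul_nonneg (norm_nonneg c) (by linarith : 0 ≤ 1 - r)
  | grade1 x =>
    obtain ⟨C, hC0, hC⟩ := exists_opNorm_coord_le hQ x
    refine ⟨C, hC0, fun n X hX => ⟨?_, fun r _ hr1 => ?_⟩⟩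
    · simpa [ncEval] using hC n X hX
    · have h1 : ncEval X (FreeAlgebra.ι ℂ x) - ncEval (fun x => (r : ℂ) • X x) (FreeAlgebra.ι ℂ x) =
          ((1 - r : ℝ) : ℂ) • X x := by
        simp [ncEval, sub_smul]
      rw [h1, opNorm_smul, Complex.norm_real, Real.norm_of_nonneg (by linarith), mul_comm]
      exact mul_le_mul_of_nonneg_right (hC n X hX) (by linarith)
  | mul p q hp hq =>
    obtain ⟨C, hC0, hC⟩ := hp
    obtain ⟨D, hD0, hD⟩ := hq
    refine ⟨2 * (C * D), by positivity, fun n X hX => ⟨?_, fun r hr0 hr1 => ?_⟩⟩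
    · rw [map_mul]
      have := (opNorm_mul (ncEval X p) (ncEval X q)).trans
        (mul_le_mul (hC n X hX).1 (hD n X hX).1 (opNorm_nonneg _) hC0)
      nlinarith [mul_nonneg hC0 hD0]
    · set Y := fun x => (r : ℂ) • X x with hY
      have h1 : ncEval X (p * q) - ncEval Y (p * q) =
          ncEval X p * (ncEval X q - ncEval Y q) + (ncEval X p - ncEval Y p) * ncEval Y q := by
        rw [map_mul, map_mul]
        noncomm_ring
      have h2 := (opNorm_mul (ncEval X p) (ncEval X q - ncEval Y q)).trans
        (mul_le_mul (hC n X hX).1 ((hD n X hX).2 r hr0 hr1) (opNorm_nonneg _) hC0)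
      have h3 := (opNorm_mul (ncEval X p - ncEval Y p) (ncEval Y q)).trans
        (mul_le_mul ((hC n X hX).2 r hr0 hr1) (hD n Y (memBallQ_ofReal_smul hX hr0 hr1)).1
          (opNorm_nonneg _) (mul_nonneg hC0 (by linarith)))
      rw [h1]
      linarith [opNorm_add (ncEval X p * (ncEval X q - ncEval Y q))
        ((ncEval X p - ncEval Y p) * ncEval Y q)]
  | add p q hp hq =>
    obtain ⟨C, hC0, hC⟩ := hp
    obtain ⟨D, hD0, hD⟩ := hq
    refine ⟨C + D, by positivity, fun n X hX => ⟨?_, fun r hr0 hr1 => ?_⟩⟩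
    · rw [map_add]
      exact (opNorm_add _ _).trans (add_le_add (hC n X hX).1 (hD n X hX).1)
    · rw [map_add, map_add, add_sub_add_comm, add_mul]
      exact (opNorm_add _ _).trans
        (add_le_add ((hC n X hX).2 r hr0 hr1) ((hD n X hX).2 r hr0 hr1))

lemma ncEvalM_eq_sum {k n : ℕ} (P : Matrix (Fin k) (Fin k) (FreeAlgebra ℂ (Fin d)))
    (X : Fin d → Matrix (Fin n) (Fin n) ℂ) :
    ncEvalM P X = ∑ a, ∑ b, Matrix.single a b (1 : ℂ) ⊗ₖ ncEval X (P a b) := by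
  ext ⟨a, i⟩ ⟨b, j⟩
  simp only [ncEvalM, Matrix.of_apply, Matrix.sum_apply, Matrix.kroneckerMap_apply,
    Matrix.single_apply]
  rw [Finset.sum_eq_single a (fun c _ hc => by simp [hc]) (by simp),
    Finset.sum_eq_single b (fun c _ hc => by simp [hc]) (by simp)]
  simp

lemma exists_opNorm_ncEvalM_sub_le (hQ : LinearIndependent ℂ Q) {k : ℕ}
    (P : Matrix (Fin k) (Fin k) (FreeAlgebra ℂ (Fin d))) :
    ∃ C : ℝ, 0 ≤ C ∧ ∀ (n : ℕ) (X : Fin d → Matrix (Fin n) (Fin n) ℂ), memBallQ Q X →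
      ∀ r : ℝ, 0 ≤ r → r < 1 →
        opNorm (ncEvalM P X - ncEvalM P fun x => (r : ℂ) • X x) ≤ C * (1 - r) := by
  choose C hC0 hC using fun a b => exists_opNorm_ncEval_le hQ (P a b)
  refine ⟨∑ a, ∑ b, C a b, Finset.sum_nonneg fun a _ => Finset.sum_nonneg fun b _ => hC0 a b,
    fun n X hX r hr0 hr1 => ?_⟩
  rw [ncEvalM_eq_sum, ncEvalM_eq_sum, ← Finset.sum_sub_distrib, Finset.sum_mul]
  refine (opNorm_sum _ _).trans (Finset.sum_le_sum fun a _ => ?_)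
  rw [← Finset.sum_sub_distrib, Finset.sum_mul]
  refine (opNorm_sum _ _).trans (Finset.sum_le_sum fun b _ => ?_)
  have h1 : ∀ M N : Matrix (Fin n) (Fin n) ℂ,
      Matrix.single a b (1 : ℂ) ⊗ₖ M - Matrix.single a b (1 : ℂ) ⊗ₖ N =
        Matrix.single a b (1 : ℂ) ⊗ₖ (M - N) := by
    intro M N
    ext p q
    simp [mul_sub]
  rw [h1]
  exact (opNorm_single_kronecker_le a b _).trans ((hC a b n X hX).2 r hr0 hr1)

end Polynomial

/-! ### The inverse of a stable atom -/

section Atom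

variable {d k l : ℕ} {Q : Fin d → Matrix (Fin l) (Fin l) ℂ}
  {P : Matrix (Fin k) (Fin k) (FreeAlgebra ℂ (Fin d))}

/-- A finite-dimensional model of the companion operators of a stable atom. -/
lemma exists_model (hstable : QStable Q P) (hatom : IsAtomPoly P) :
    ∃ (m : ℕ) (A : Fin d → Module.End ℂ (EuclideanSpace ℂ (Fin m)))
      (Θ : EuclideanSpace ℂ (Fin m) →ₗ[ℂ] (Fin k → FreeAlgebra ℂ (Fin d)))
      (B : EuclideanSpace ℂ (Fin k) →ₗ[ℂ] EuclideanSpace ℂ (Fin m)), Stable Q A ∧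
      (∀ x v, Θ (A x v) = companion P x (Θ v)) ∧
      (∀ c, Θ (B c) = constRow d k c) ∧
      ∀ W, W ≤ pre A W → (∃ N, W ≤ (pre A)^[N] ⊥) ∨ ∃ N, ⊤ ≤ (pre A)^[N] W := by
  have hP := isUnit_constMat hstable
  obtain ⟨U, hUfg, hU, hUconst⟩ := exists_invariant P
  have : Module.Finite ℂ U := Module.Finite.iff_fg.2 hUfg
  let e : EuclideanSpace ℂ (Fin (Module.finrank ℂ U)) ≃ₗ[ℂ] U :=
    LinearEquiv.ofFinrankEq _ _ (by simp)
  let A : Fin d → Module.End ℂ (EuclideanSpace ℂ (Fin (Module.finrank ℂ U))) := fun x =>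
    e.symm.toLinearMap ∘ₗ ((companion P x).restrict fun v hv => mem_pre.1 (hU hv) x) ∘ₗ
      e.toLinearMap
  let Θ := U.subtype ∘ₗ e.toLinearMap
  have hΘ : ∀ x v, Θ (A x v) = companion P x (Θ v) := by
    intro x v
    simp [Θ, A]
  have hinj : Function.Injective Θ := U.injective_subtype.comp e.injective
  refine ⟨_, A, Θ, e.symm.toLinearMap ∘ₗ ((constRow d k).codRestrict U hUconst) ∘ₗ
    (WithLp.linearEquiv 2 ℂ (Fin k → ℂ)).toLinearMap,
    (stable_companion hP hstable).of_injective Θ hΘ hinj, hΘ, fun c => by simp [Θ], fun W hW => ?_⟩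
  have hW' : W.map Θ ≤ pre (companion P) (W.map Θ) := by
    rintro _ ⟨v, hv, rfl⟩
    exact mem_pre.2 fun x => ⟨A x v, mem_pre.1 (hW hv) x, hΘ x v⟩
  rcases isAtomPoly_dichotomy hatom hP hW' with h | h
  · obtain ⟨N, hN⟩ := le_pre_iterate_of_fg (bot_le_pre _) ((IsNoetherian.noetherian W).map Θ) h
    refine Or.inl ⟨N, ?_⟩
    have := Submodule.map_le_iff_le_comap.1 hN
    rwa [comap_pre_iterate Θ hΘ, Submodule.comap_bot, LinearMap.ker_eq_bot.2 hinj] at this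
  · obtain ⟨N, hN⟩ := le_pre_iterate_of_fg hW' hUfg (le_top.trans h)
    refine Or.inr ⟨N, fun v _ => ?_⟩
    rw [← Submodule.comap_map_eq_of_injective hinj W, ← comap_pre_iterate Θ hΘ]
    exact hN (e v).2

lemma exists_opNorm_inv_le (hQ : LinearIndependent ℂ Q) (hstable : QStable Q P)
    (hatom : IsAtomPoly P) :
    ∃ C : ℝ, 0 ≤ C ∧ ∀ r : ℝ, 0 ≤ r → r < 1 →
      ∀ (n : ℕ) (X : Fin d → Matrix (Fin (n + 1)) (Fin (n + 1)) ℂ), memBallQ Q X →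
        opNorm (ncEvalM P fun x => (r : ℂ) • X x)⁻¹ ≤ C / (1 - r) := by
  obtain ⟨m, A, Θ, B, hA, hΘ, hB, hdich⟩ := exists_model hstable hatom
  obtain ⟨C, hC0, hC⟩ := hA.exists_resolvent_le hQ hdich
  obtain ⟨β, hβ0, hβ⟩ := exists_tupleNorm_map_le B
  obtain ⟨γ, hγ0, hγ⟩ := exists_tupleNorm_map_le
    ((WithLp.linearEquiv 2 ℂ (Fin k → ℂ)).symm.toLinearMap ∘ₗ lead P ∘ₗ Θ)
  refine ⟨γ * (C * β), by positivity, fun r hr0 hr1 n X hX => ?_⟩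
  have hr : 0 < 1 - r := by linarith
  set Y := fun x => (r : ℂ) • X x with hY
  have hYball : memBallQ Q Y := memBallQ_ofReal_smul hX hr0 hr1
  refine opNorm_le_of_vecMul (by positivity) fun v => ?_
  let b : Fin (n + 1) → EuclideanSpace ℂ (Fin k) := fun i => WithLp.toLp 2 fun a => v (a, i)
  obtain ⟨ξ, hξ⟩ : ∃ ξ, ξ - ampl A Y ξ = fun i => B (b i) := by
    have hinj : Function.Injective ((1 : Module.End ℂ (Fin (n + 1) → EuclideanSpace ℂ (Fin m))) -
        ampl A Y) := by
      refine (injective_iff_map_eq_zero _).2 fun ξ hξ => hA _ Y hYball ξ ?_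
      exact (sub_eq_zero.1 hξ).symm
    exact LinearMap.injective_iff_surjective.1 hinj fun i => B (b i)
  have h1 : Matrix.vecMul (fun p => lead P (Θ (ξ p.2)) p.1) (ncEvalM P Y) = v := by
    refine vecMul_lead (b := fun i a => v (a, i)) (isUnit_constMat hstable) Y
      (ξ := fun i => Θ (ξ i)) ?_
    funext i
    rw [Pi.sub_apply, ← ampl_map Θ hΘ, ← map_sub, ← Pi.sub_apply, hξ, hB]
  have hdet : IsUnit (ncEvalM P Y).det :=
    (Matrix.isUnit_iff_isUnit_det _).1 (hstable n Y hYball)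
  have h2 : Matrix.vecMul v (ncEvalM P Y)⁻¹ = fun p => lead P (Θ (ξ p.2)) p.1 := by
    rw [← h1, Matrix.vecMul_vecMul, Matrix.mul_nonsing_inv _ hdet, Matrix.vecMul_one]
  have hnorm : ∀ (u : Fin (n + 1) → Fin k → ℂ),
      ∑ p : Fin k × Fin (n + 1), ‖u p.2 p.1‖ ^ 2 =
        tupleNorm (fun i => (WithLp.toLp 2 (u i) : EuclideanSpace ℂ (Fin k))) ^ 2 := by
    intro u
    rw [tupleNorm_sq, Fintype.sum_prod_type, Finset.sum_comm]
    simp only [EuclideanSpace.norm_sq_eq]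
  rw [h2, hnorm fun i a => lead P (Θ (ξ i)) a, hnorm fun i a => v (a, i), ← mul_pow]
  refine pow_le_pow_left₀ (tupleNorm_nonneg _) ?_ 2
  calc _ ≤ γ * tupleNorm ξ := hγ _ ξ
    _ ≤ γ * (C / (1 - r) * (β * tupleNorm b)) := by
        refine mul_le_mul_of_nonneg_left ((hC r hr0 hr1 _ X hX ξ _ hξ).trans ?_) hγ0
        exact mul_le_mul_of_nonneg_left (hβ _ b) (by positivity)
    _ = _ := by
        simp only [b]
        ring

end Atom

end NCAtom

end

/-- **Theorem A (free NGN inequality for `Q`-stable atoms).**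
If `P ∈ M_k(ℂ⟨Z⟩)` is a `Q`-stable atom, then the dilated NGN quantities are
uniformly bounded: there is a finite `C` such that for all `r ∈ [0,1)` and all
`X ∈ 𝔻_Q`, `P(rX)` is invertible and `‖P(rX)⁻¹P(X)‖ ≤ C`, `‖P(X)P(rX)⁻¹‖ ≤ C`. -/
theorem ngn_Q_stable_atom {d k l : ℕ} (hd : 0 < d) (hk : 0 < k) (hl : 0 < l)
    (Q : Fin d → Matrix (Fin l) (Fin l) ℂ) (hQ : LinearIndependent ℂ Q)
    (P : Matrix (Fin k) (Fin k) (FreeAlgebra ℂ (Fin d)))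
    (hstable : QStable Q P) (hatom : IsAtomPoly P) :
    ∃ C : ℝ, ∀ (r : ℝ), 0 ≤ r → r < 1 →
      ∀ (n : ℕ) (X : Fin d → Matrix (Fin (n + 1)) (Fin (n + 1)) ℂ), memBallQ Q X →
        IsUnit (ncEvalM P (fun i => (r : ℂ) • X i)) ∧
        opNorm ((ncEvalM P (fun i => (r : ℂ) • X i))⁻¹ * ncEvalM P X) ≤ C ∧
        opNorm (ncEvalM P X * (ncEvalM P (fun i => (r : ℂ) • X i))⁻¹) ≤ C := by
  obtain ⟨C, hC0, hC⟩ := NCAtom.exists_opNorm_inv_le hQ hstable hatom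
  obtain ⟨D, hD0, hD⟩ := NCAtom.exists_opNorm_ncEvalM_sub_le hQ P
  refine ⟨1 + C * D, fun r hr0 hr1 n X hX => ?_⟩
  have hr : 0 < 1 - r := by linarith
  have hunit := hstable n _ (NCAtom.memBallQ_ofReal_smul hX hr0 hr1)
  have hinv := hC r hr0 hr1 n X hX
  have hsub := hD _ X hX r hr0 hr1
  set M := ncEvalM P fun i => (r : ℂ) • X i with hM
  set N := ncEvalM P X with hN
  have hdet : IsUnit M.det := (Matrix.isUnit_iff_isUnit_det _).1 hunit
  have hprod : opNorm M⁻¹ * opNorm (N - M) ≤ C * D := by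
    refine (mul_le_mul hinv hsub (NCAtom.opNorm_nonneg _) (by positivity)).trans (le_of_eq ?_)
    field_simp
  refine ⟨hunit, ?_, ?_⟩
  · have h : M⁻¹ * N = 1 + M⁻¹ * (N - M) := by
      rw [Matrix.mul_sub, Matrix.nonsing_inv_mul _ hdet, add_sub_cancel]
    rw [h]
    exact (NCAtom.opNorm_add _ _).trans
      (add_le_add NCAtom.opNorm_one_le ((NCAtom.opNorm_mul _ _).trans hprod))
  · have h : N * M⁻¹ = 1 + (N - M) * M⁻¹ := by
      rw [Matrix.sub_mul, Matrix.mul_nonsing_inv _ hdet, add_sub_cancel]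
    rw [h]
    exact (NCAtom.opNorm_add _ _).trans
      (add_le_add NCAtom.opNorm_one_le ((NCAtom.opNorm_mul _ _).trans (by rwa [mul_comm])))
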